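/- arXiv:2304.13196 — 3 statements merged into one kernel-verified Lean document; each statement's English description precedes it below -/
import Mathlib

section
/- Let F be a free group of finite rank m ≥ 2, let r be an odd prime, and let 𝒪 ⊆ F be the set of primitive elements, i.e. elements that belong to some free basis of F. Then there exists a finite-index normal subgroup R of F whose index [F : R] is a power of r and such that H₁^𝒪(R;ℚ) is a proper ℚ-subspace of H₁(R;ℚ) = Abelianization(R) ⊗_ℤ ℚ. -/
open scoped TensorProduct


/-- Images in `H₁(R;ℚ) = ℚ ⊗ Abelianization R` of powers `x^m ∈ R` of elements `x ∈ O`. -/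
def elevationImages {π : Type} [Group π] (R : Subgroup π) (O : Set π) :
    Set (ℚ ⊗[ℤ] Additive (Abelianization ↥R)) :=
  {v | ∃ x ∈ O, ∃ m : ℤ, ∃ h : x ^ m ∈ R,
    v = (1 : ℚ) ⊗ₜ[ℤ] Additive.ofMul (Abelianization.of (⟨x ^ m, h⟩ : ↥R))}

/-- The `O`-homology `H₁^O(R;ℚ)`: the ℚ-span of the images of elevations of elements of `O`. -/
def OHomology {π : Type} [Group π] (R : Subgroup π) (O : Set π) :
    Submodule ℚ (ℚ ⊗[ℤ] Additive (Abelianization ↥R)) :=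
  Submodule.span ℚ (elevationImages R O)

/-- A primitive element of a free group: an element belonging to some free basis. -/
def IsPrimitiveElement {m : ℕ} (x : FreeGroup (Fin m)) : Prop :=
  ∃ (ι : Type) (b : FreeGroupBasis ι (FreeGroup (Fin m))) (i : ι), b i = x

namespace PrimHom

section top
variable {m : ℕ} (R : Subgroup (FreeGroup (Fin m))) [R.Normal]

open Classical in
/-- the generators acting on `G × ℚ` -/
noncomputable def genPerm (i1 a : Fin m) :
    Equiv.Perm ((FreeGroup (Fin m) ⧸ R) × ℚ) where
  toFun p := ((FreeGroup.of a : FreeGroup (Fin m) ⧸ R) * p.1,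
    p.2 + if a = i1 ∧ p.1 = 1 then 1 else 0)
  invFun p := ((FreeGroup.of a : FreeGroup (Fin m) ⧸ R)⁻¹ * p.1,
    p.2 - if a = i1 ∧ (FreeGroup.of a : FreeGroup (Fin m) ⧸ R)⁻¹ * p.1 = 1 then 1 else 0)
  left_inv p := by simp
  right_inv p := by simp

noncomputable def actHom (i1 : Fin m) :
    FreeGroup (Fin m) →* Equiv.Perm ((FreeGroup (Fin m) ⧸ R) × ℚ) :=
  FreeGroup.lift (genPerm R i1)

noncomputable def coc (i1 : Fin m) (w : FreeGroup (Fin m)) (h : FreeGroup (Fin m) ⧸ R) : ℚ :=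
  (actHom R i1 w (h, 0)).2

lemma actHom_apply (i1 : Fin m) (w : FreeGroup (Fin m)) :
    ∀ (h : FreeGroup (Fin m) ⧸ R) (q : ℚ),
    actHom R i1 w (h, q) = ((w : FreeGroup (Fin m) ⧸ R) * h, q + coc R i1 w h) := by
  induction w using FreeGroup.induction_on with
  | C1 => intro h q; simp [coc]
  | of a => intro h q; simp [coc, actHom, genPerm]
  | inv_of a _ =>
    intro h q
    simp [coc, actHom, genPerm, Equiv.Perm.inv_def, Equiv.symm, sub_eq_add_neg]
  | mul x y hx hy =>
    intro h q
    have h1 : coc R i1 (x * y) h = coc R i1 y h + coc R i1 x (y * h) := by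
      rw [coc, map_mul, Equiv.Perm.mul_apply, hy, hx]; simp
    rw [map_mul, Equiv.Perm.mul_apply, hy, hx, h1]
    simp [mul_assoc, add_assoc]

lemma coc_mul (i1 : Fin m) (x y : FreeGroup (Fin m)) (h : FreeGroup (Fin m) ⧸ R) :
    coc R i1 (x * y) h = coc R i1 y h + coc R i1 x (y * h) := by
  rw [coc, map_mul, Equiv.Perm.mul_apply, actHom_apply, actHom_apply]; simp

lemma coc_one (i1 : Fin m) (h : FreeGroup (Fin m) ⧸ R) :
    coc R i1 1 h = 0 := by simp [coc]

open Classical in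
lemma coc_of (i1 a : Fin m) (h : FreeGroup (Fin m) ⧸ R) :
    coc R i1 (FreeGroup.of a) h = if a = i1 ∧ h = 1 then 1 else 0 := by
  simp [coc, actHom, genPerm]

lemma coc_pow_of (i1 a : Fin m) (ha : a ≠ i1) (n : ℕ) : ∀ (h : FreeGroup (Fin m) ⧸ R),
    coc R i1 (FreeGroup.of a ^ n) h = 0 := by
  induction n with
  | zero => intro h; simp [coc_one]
  | succ n ih => intro h; rw [pow_succ, coc_mul, ih, coc_of]; simp [ha]

lemma coc_pow_inv (i1 : Fin m) (x : FreeGroup (Fin m)) (j : ℤ) (hj : x ^ j ∈ R) (e : ℕ) :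
    coc R i1 (x ^ j) ((x : FreeGroup (Fin m) ⧸ R) ^ e) = coc R i1 (x ^ j) 1 := by
  induction e with
  | zero => simp
  | succ e ih =>
    rw [← ih]
    have h1 := coc_mul R i1 (x ^ j) x ((x : FreeGroup (Fin m) ⧸ R) ^ e)
    have h2 := coc_mul R i1 x (x ^ j) ((x : FreeGroup (Fin m) ⧸ R) ^ e)
    have h3 : ((x ^ j : FreeGroup (Fin m)) : FreeGroup (Fin m) ⧸ R) = 1 :=
      (QuotientGroup.eq_one_iff _).2 hj
    have h4 : x ^ j * x = x * x ^ j := ((Commute.refl x).zpow_left j).eq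
    rw [h4, h2, h3, one_mul, ← pow_succ'] at h1
    linarith

noncomputable def psi (i1 : Fin m) (z : FreeGroup (Fin m) ⧸ R) : R →* Multiplicative ℚ where
  toFun g := Multiplicative.ofAdd (coc R i1 g z - coc R i1 g 1)
  map_one' := by simp [coc_one]
  map_mul' g g' := by
    have h3 : ((g' : FreeGroup (Fin m)) : FreeGroup (Fin m) ⧸ R) = 1 :=
      (QuotientGroup.eq_one_iff _).2 g'.2
    rw [← ofAdd_add, Subgroup.coe_mul, coc_mul, coc_mul, h3]
    congr 1
    simp only [one_mul]
    ring

noncomputable def psiLin (i1 : Fin m) (z : FreeGroup (Fin m) ⧸ R) :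
    ℚ ⊗[ℤ] Additive (Abelianization ↥R) →ₗ[ℚ] ℚ :=
  LinearMap.liftBaseChange ℚ
    (MonoidHom.toAdditiveLeft (Abelianization.lift (psi R i1 z))).toIntLinearMap

lemma psiLin_apply (i1 : Fin m) (z : FreeGroup (Fin m) ⧸ R) (g : R) :
    psiLin R i1 z ((1 : ℚ) ⊗ₜ[ℤ] Additive.ofMul (Abelianization.of g)) =
      coc R i1 g z - coc R i1 g 1 := by
  simp [psiLin, psi]

theorem proper_of_central (O : Set (FreeGroup (Fin m))) (z : FreeGroup (Fin m) ⧸ R)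
    (hz : z ≠ 1) (hc : ∀ g, g * z = z * g)
    (hO : ∀ x ∈ O, ∃ e : ℕ, (x : FreeGroup (Fin m) ⧸ R) ^ e = z)
    (i0 i1 : Fin m) (hi : i0 ≠ i1) (h0 : FreeGroup.of i0 ∈ O) :
    OHomology R O ≠ ⊤ := by
  intro htop
  have hle : OHomology R O ≤ LinearMap.ker (psiLin R i1 z) := by
    refine Submodule.span_le.2 ?_
    rintro v ⟨x, hx, j, hj, rfl⟩
    obtain ⟨e, he⟩ := hO x hx
    have := coc_pow_inv R i1 x j hj e
    rw [he] at this
    simp only [SetLike.mem_coe, LinearMap.mem_ker]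
    rw [psiLin_apply]
    simp [this]
  obtain ⟨n, hn⟩ := hO _ h0
  set y := (FreeGroup.of i0 : FreeGroup (Fin m)) ^ n with hy
  have hyz : ((y : FreeGroup (Fin m)) : FreeGroup (Fin m) ⧸ R) = z := by
    rw [← hn]; rfl
  set x := (FreeGroup.of i1 : FreeGroup (Fin m)) with hx
  set g := (x * y)⁻¹ * (y * x) with hg
  have hgR : g ∈ R := by
    rw [← QuotientGroup.eq]
    rw [QuotientGroup.mk_mul, QuotientGroup.mk_mul, hyz, hc]
  have hg1 : ((g : FreeGroup (Fin m)) : FreeGroup (Fin m) ⧸ R) = 1 :=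
      (QuotientGroup.eq_one_iff _).2 hgR
  have key : ∀ h, coc R i1 g h = coc R i1 x h - coc R i1 x (z * h) := by
    intro h
    have h1 : (x * y) * g = y * x := by rw [hg, mul_inv_cancel_left]
    have h2 := congrArg (fun w => coc R i1 w h) h1
    simp only [coc_mul, hg1, one_mul, hyz] at h2
    rw [hy, coc_pow_of R i1 i0 hi, coc_pow_of R i1 i0 hi] at h2
    linarith
  have hmem : (1 : ℚ) ⊗ₜ[ℤ] Additive.ofMul (Abelianization.of (⟨g, hgR⟩ : R)) ∈
      LinearMap.ker (psiLin R i1 z) := hle (htop ▸ Submodule.mem_top)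
  rw [LinearMap.mem_ker, psiLin_apply] at hmem
  simp only [key, hx, coc_of] at hmem
  simp [hz] at hmem
  split_ifs at hmem <;> norm_num at hmem

end top

section matrices
variable {r d : ℕ}

/-- unitriangular with prescribed superdiagonal -/
def UT (l : Fin d → ZMod r) (A : Matrix (Fin (d + 1)) (Fin (d + 1)) (ZMod r)) : Prop :=
  (∀ a b, b < a → A a b = 0) ∧ (∀ a, A a a = 1) ∧ ∀ k : Fin d, A k.castSucc k.succ = l k

lemma UT.mul {l l' : Fin d → ZMod r} {A B : Matrix (Fin (d + 1)) (Fin (d + 1)) (ZMod r)}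
    (hA : UT l A) (hB : UT l' B) : UT (l + l') (A * B) := by
  obtain ⟨hA1, hA2, hA3⟩ := hA
  obtain ⟨hB1, hB2, hB3⟩ := hB
  refine ⟨fun a b hab => ?_, fun a => ?_, fun k => ?_⟩
  · rw [Matrix.mul_apply]
    refine Finset.sum_eq_zero fun c _ => ?_
    rcases lt_or_ge c a with h | h
    · rw [hA1 a c h, zero_mul]
    · rw [hB1 c b (lt_of_lt_of_le hab h), mul_zero]
  · rw [Matrix.mul_apply, Fintype.sum_eq_single a, hA2, hB2, one_mul]
    intro c hc
    rcases lt_or_gt_of_ne hc with h | h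
    · rw [hA1 a c h, zero_mul]
    · rw [hB1 c a h, mul_zero]
  · rw [Matrix.mul_apply, Fintype.sum_eq_add k.castSucc k.succ (Fin.castSucc_lt_succ).ne,
      hA2, hB2, hA3, hB3]
    · simp [add_comm]
    · rintro c ⟨h1, h2⟩
      rcases lt_or_gt_of_ne h1 with h | h
      · rw [hA1 _ c h, zero_mul]
      · rw [hB1 c, mul_zero]
        rw [Fin.castSucc_lt_iff_succ_le] at h
        exact lt_of_le_of_ne h h2.symm

lemma UT.one : UT (0 : Fin d → ZMod r) 1 := by
  refine ⟨fun a b h => Matrix.one_apply_ne h.ne', fun a => Matrix.one_apply_eq a, fun k => ?_⟩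
  exact Matrix.one_apply_ne (Fin.castSucc_lt_succ).ne

lemma UT.pow {l : Fin d → ZMod r} {A : Matrix (Fin (d + 1)) (Fin (d + 1)) (ZMod r)}
    (hA : UT l A) (n : ℕ) : UT (n • l) (A ^ n) := by
  induction n with
  | zero => simpa using UT.one
  | succ n ih => rw [pow_succ, succ_nsmul]; exact ih.mul hA

/-- the top corner elements -/
def cor (c : ZMod r) : Matrix (Fin (d + 1)) (Fin (d + 1)) (ZMod r) :=
  1 + Matrix.single 0 (Fin.last d) c

lemma cor_zero : (cor 0 : Matrix (Fin (d + 1)) (Fin (d + 1)) (ZMod r)) = 1 := by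
  simp [cor]

lemma cor_mul (hd : d ≠ 0) (c c' : ZMod r) :
    (cor c * cor c' : Matrix (Fin (d + 1)) (Fin (d + 1)) (ZMod r)) = cor (c + c') := by
  have h : Fin.last d ≠ 0 := by
    intro h; apply hd; simpa [Fin.ext_iff] using h
  simp only [cor, add_mul, mul_add, one_mul, mul_one, Matrix.single_add]
  rw [Matrix.single_mul_single_of_ne _ _ _ _ h]
  abel

lemma cor_pow (hd : d ≠ 0) (c : ZMod r) (n : ℕ) :
    (cor c ^ n : Matrix (Fin (d + 1)) (Fin (d + 1)) (ZMod r)) = cor ((n : ZMod r) * c) := by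
  induction n with
  | zero => simp [cor_zero]
  | succ n ih => rw [pow_succ, ih, cor_mul hd]; congr 1; push_cast; ring

lemma cor_comm {l : Fin d → ZMod r} {A : Matrix (Fin (d + 1)) (Fin (d + 1)) (ZMod r)}
    (hA : UT l A) (c : ZMod r) : A * cor c = cor c * A := by
  obtain ⟨hA1, hA2, hA3⟩ := hA
  have h1 : A * Matrix.single 0 (Fin.last d) c = Matrix.single 0 (Fin.last d) c := by
    ext a b
    by_cases hb : b = Fin.last d
    · subst hb
      rw [Matrix.mul_single_apply_same]
      by_cases ha : a = 0
      · subst ha; simp [hA2]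
      · rw [hA1 a 0 (Fin.pos_iff_ne_zero.2 ha), zero_mul, Matrix.single_apply_of_row_ne (Ne.symm ha)]
    · rw [Matrix.mul_single_apply_of_ne _ _ _ _ _ hb, Matrix.single_apply_of_col_ne _ _ (Ne.symm hb)]
  have h2 : (Matrix.single 0 (Fin.last d) c : Matrix (Fin (d + 1)) (Fin (d + 1)) (ZMod r)) * A = Matrix.single 0 (Fin.last d) c := by
    ext a b
    by_cases ha : a = 0
    · subst ha
      rw [Matrix.single_mul_apply_same]
      by_cases hb : b = Fin.last d
      · subst hb; simp [hA2]
      · rw [hA1 _ b (Fin.lt_last_iff_ne_last.2 hb), mul_zero,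
          Matrix.single_apply_of_col_ne _ _ (Ne.symm hb)]
    · rw [Matrix.single_mul_apply_of_ne _ _ _ _ _ ha, Matrix.single_apply_of_row_ne (Ne.symm ha)]
  rw [cor, mul_add, add_mul, h1, h2, mul_one, one_mul]

lemma strict_pow (N : Matrix (Fin (d + 1)) (Fin (d + 1)) (ZMod r))
    (hN : ∀ a b, b ≤ a → N a b = 0) (i : ℕ) :
    ∀ a b : Fin (d + 1), (b : ℕ) < a + i → (N ^ i) a b = 0 := by
  induction i with
  | zero =>
    intro a b h
    rw [pow_zero, Matrix.one_apply_ne]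
    rintro rfl
    simp at h
  | succ i ih =>
    intro a b h
    rw [pow_succ, Matrix.mul_apply]
    refine Finset.sum_eq_zero fun c _ => ?_
    by_cases hc : (c : ℕ) < a + i
    · rw [ih a c hc, zero_mul]
    · rw [hN c b (by rw [Fin.le_def]; omega), mul_zero]

lemma strict_pow_corner (N : Matrix (Fin (d + 1)) (Fin (d + 1)) (ZMod r))
    (hN : ∀ a b, b ≤ a → N a b = 0) (L : ℕ → ZMod r)
    (hL : ∀ k : Fin d, N k.castSucc k.succ = L k) (i : ℕ) :
    ∀ hi : i < d + 1, (N ^ i) 0 ⟨i, hi⟩ = ∏ k ∈ Finset.range i, L k := by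
  induction i with
  | zero => intro hi; simp
  | succ i ih =>
    intro hi
    rw [pow_succ, Matrix.mul_apply, Finset.prod_range_succ,
      Fintype.sum_eq_single (⟨i, by omega⟩ : Fin (d + 1)), ih, ← hL ⟨i, by omega⟩]
    · rfl
    · intro c hc
      by_cases h : (c : ℕ) < i
      · rw [strict_pow N hN i 0 c (by simpa using h), zero_mul]
      · rw [hN c, mul_zero]
        have : (c : ℕ) ≠ i := fun h' => hc (Fin.ext h')
        rw [Fin.le_def]; simp only; omega

lemma UT.pow_top [Fact r.Prime] {n : ℕ} (hd : d = r ^ n) {l : Fin d → ZMod r}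
    {A : Matrix (Fin (d + 1)) (Fin (d + 1)) (ZMod r)}
    (hA : UT l A) : A ^ d = cor (∏ k, l k) := by
  obtain ⟨hA1, hA2, hA3⟩ := hA
  set N := A - 1 with hNdef
  have hN : ∀ a b, b ≤ a → N a b = 0 := by
    intro a b h
    rcases h.lt_or_eq with h | h
    · simp [hNdef, hA1 a b h, Matrix.one_apply_ne h.ne']
    · subst h; simp [hNdef, hA2]
  have hAN : A = 1 + N := by simp [hNdef]
  have h1 : A ^ d = 1 + N ^ d := by
    have h2 : ∀ e, e = r ^ n → (1 + N) ^ e = 1 + N ^ e := by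
      rintro e rfl
      rw [add_pow_char_pow_of_commute _ _ (Commute.one_left N), one_pow]
    rw [hAN]; exact h2 d hd
  rw [h1, cor]
  congr 1
  ext a b
  by_cases h : a = 0 ∧ b = Fin.last d
  · obtain ⟨rfl, rfl⟩ := h
    have := strict_pow_corner N hN (fun k => if h : k < d then l ⟨k, h⟩ else 0) (by
      intro k
      simp [hNdef, hA3, Matrix.one_apply_ne (Fin.castSucc_lt_succ (i := k)).ne]) d (by omega)
    rw [Matrix.single_apply_same]
    rw [Finset.prod_range] at this
    simp only [Fin.is_lt, dite_true] at this
    exact this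
  · rw [Matrix.single_apply_of_ne _ _ _ _ _ (by tauto)]
    apply strict_pow N hN
    by_contra h'
    apply h
    have h3 := b.is_lt
    clear hd
    constructor <;> apply Fin.ext <;> simp only [Fin.val_zero, Fin.val_last] <;> omega

end matrices

section forms
open LinearAlgebra.Projectivization

lemma exists_form {K V : Type} [Field K] [AddCommGroup V] [Module K V] (u : V) (hu : u ≠ 0)
    (v : V) : ∃ f : V →ₗ[K] K, f u = 1 ∧ (v ∉ Submodule.span K {u} → f v = 0) := by
  by_cases hv : v ∈ Submodule.span K {u}
  · obtain ⟨f, hf⟩ := Module.Projective.exists_dual_eq_one K hu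
    exact ⟨f, hf, fun h => absurd hv h⟩
  · have hu' : u ∉ Submodule.span K {v} := by
      intro h
      obtain ⟨c, rfl⟩ := Submodule.mem_span_singleton.1 h
      apply hv
      have hc : c ≠ 0 := by rintro rfl; simp at hu
      exact Submodule.mem_span_singleton.2 ⟨c⁻¹, by rw [smul_smul, inv_mul_cancel₀ hc, one_smul]⟩
    obtain ⟨f, hf, hf'⟩ := Submodule.exists_le_ker_of_notMem hu'
    refine ⟨(f u)⁻¹ • f, by simp [hf], fun _ => ?_⟩
    have : f v = 0 := hf' (Submodule.mem_span_singleton_self v)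
    simp [this]

lemma exists_forms (K V : Type) [Field K] [AddCommGroup V] [Module K V] [Finite V]
    (d : ℕ) (hd : Nat.card V = d) :
    ∃ (J : Type) (_ : Fintype J) (l : J → Fin d → V →ₗ[K] K),
      ∀ v, v ≠ 0 → ∑ j, ∏ k, l j k v ≠ 0 := by
  classical
  have e : V ≃ Fin d := (Finite.equivFin V).trans (finCongr hd)
  have : Finite (ℙ K V) := Quotient.finite _
  have := Fintype.ofFinite (ℙ K V)
  have H : ∀ (p : ℙ K V) (v : V), ∃ f : V →ₗ[K] K, f p.rep = 1 ∧
      (v ∉ Submodule.span K {p.rep} → f v = 0) := fun p v => exists_form _ p.rep_nonzero v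
  choose f hf1 hf2 using H
  refine ⟨ℙ K V, inferInstance, fun p k => f p (e.symm k), fun v hv => ?_⟩
  rw [Fintype.sum_eq_single (Projectivization.mk K v hv)]
  · obtain ⟨a, ha⟩ := Projectivization.exists_smul_eq_mk_rep K v hv
    rw [Finset.prod_ne_zero_iff]
    intro k _ h0
    have := hf1 (Projectivization.mk K v hv) (e.symm k)
    rw [← ha, Units.smul_def, map_smul, h0] at this
    simp at this
  · intro p hp
    refine Finset.prod_eq_zero (Finset.mem_univ (e v)) ?_
    simp only [Equiv.symm_apply_apply]
    apply hf2
    intro h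
    obtain ⟨c, hc⟩ := Submodule.mem_span_singleton.1 h
    apply hp
    rw [← p.mk_rep]
    exact ((Projectivization.mk_eq_mk_iff' K v p.rep hv p.rep_nonzero).2 ⟨c, hc⟩).symm

end forms

section group
variable {m r : ℕ}

/-- mod r abelianization -/
def ab (m r : ℕ) : FreeGroup (Fin m) →* Multiplicative (Fin m → ZMod r) :=
  FreeGroup.lift fun a => Multiplicative.ofAdd (Pi.single a 1)

lemma hom_of_ab (h : FreeGroup (Fin m) →* Multiplicative (ZMod r)) (w : FreeGroup (Fin m)) :
    (h w).toAdd = ∑ a, (ab m r w).toAdd a * (h (FreeGroup.of a)).toAdd := by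
  induction w using FreeGroup.induction_on with
  | C1 => simp
  | of b =>
    rw [Fintype.sum_eq_single b]
    · simp [ab]
    · intro a ha; simp [ab, ha]
  | inv_of b hb => simp only [map_inv, toAdd_inv, hb, Pi.neg_apply, neg_mul, Finset.sum_neg_distrib]
  | mul x y hx hy =>
    simp only [map_mul, toAdd_mul, hx, hy, Pi.add_apply, add_mul, Finset.sum_add_distrib]

lemma ab_primitive [Fact r.Prime] (x : FreeGroup (Fin m)) (hx : IsPrimitiveElement x) :
    (ab m r x).toAdd ≠ 0 := by
  obtain ⟨ι, b, i, rfl⟩ := hx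
  intro h0
  have h := hom_of_ab (r := r) (b.lift fun _ => Multiplicative.ofAdd 1) (b i)
  rw [h0] at h
  simp at h


/-- unitriangular matrix with given superdiagonal and zeros above -/
def sup {d : ℕ} (l : Fin d → ZMod r) : Matrix (Fin (d + 1)) (Fin (d + 1)) (ZMod r) :=
  Matrix.of fun a b => if a = b then 1 else
    if h : (a : ℕ) + 1 = b then l ⟨a, by have := b.is_lt; omega⟩ else 0

lemma UT_sup {d : ℕ} (l : Fin d → ZMod r) : UT l (sup l) := by
  refine ⟨fun a b h => ?_, fun a => ?_, fun k => ?_⟩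
  · have h' : (b : ℕ) < a := h
    have h1 : ¬ ((a : ℕ) + 1 = b) := by omega
    simp [sup, h.ne', h1]
  · simp [sup]
  · simp [sup, (Fin.castSucc_lt_succ (i := k)).ne]

lemma UT.pow_eq_one [Fact r.Prime] {d n : ℕ} (hd : d = r ^ n) {l : Fin d → ZMod r}
    {A : Matrix (Fin (d + 1)) (Fin (d + 1)) (ZMod r)}
    (hA : UT l A) : A ^ (d * r) = 1 := by
  have h0 : d ≠ 0 := by rw [hd]; exact pow_ne_zero _ (Fact.out : r.Prime).ne_zero
  rw [pow_mul, hA.pow_top hd, cor_pow h0]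
  simp [cor_zero]

variable [Fact r.Prime] {d : ℕ}

lemma dr_ne (hd : d = r ^ m) : d * r ≠ 0 := by
  rw [hd]; exact mul_ne_zero (pow_ne_zero _ (Fact.out : r.Prime).ne_zero)
    (Fact.out : r.Prime).ne_zero

noncomputable def phi (hd : d = r ^ m) (l : Fin d → (Fin m → ZMod r) →ₗ[ZMod r] ZMod r) :
    FreeGroup (Fin m) →* (Matrix (Fin (d + 1)) (Fin (d + 1)) (ZMod r))ˣ :=
  FreeGroup.lift fun a => Units.ofPowEqOne (sup fun k => l k (Pi.single a 1)) (d * r)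
    ((UT_sup _).pow_eq_one hd) (dr_ne hd)

lemma phi_UT (hd : d = r ^ m) (l : Fin d → (Fin m → ZMod r) →ₗ[ZMod r] ZMod r)
    (w : FreeGroup (Fin m)) :
    UT (fun k => l k (ab m r w).toAdd) (phi hd l w : Matrix (Fin (d + 1)) (Fin (d + 1)) (ZMod r)) := by
  induction w using FreeGroup.induction_on with
  | C1 =>
    have := UT.one (r := r) (d := d)
    convert this using 1
    · ext k; simp
    · simp
  | of a => simpa [phi, ab] using UT_sup _
  | inv_of a ha =>
    have h1 := ha.pow_eq_one hd
    have h2 : (phi hd l (FreeGroup.of a))⁻¹ = phi hd l (FreeGroup.of a) ^ (d * r - 1) := by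
      rw [inv_eq_iff_mul_eq_one, ← pow_succ', Nat.sub_add_cancel (Nat.pos_of_ne_zero (dr_ne hd))]
      ext1
      simpa using h1
    rw [map_inv (phi hd l), h2, Units.val_pow_eq_pow_val]
    have h3 := ha.pow (d * r - 1)
    have h4 : ((d * r - 1 : ℕ) : ZMod r) = -1 := by
      rw [Nat.cast_sub (Nat.pos_of_ne_zero (dr_ne hd))]; simp
    convert h3 using 1
    ext k
    simp [h4]
  | mul x y hx hy =>
    have := hx.mul hy
    rw [map_mul (phi hd l), Units.val_mul]
    convert this using 1
    ext k
    simp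

variable {J : Type} [Fintype J]

/-- `w` maps to a top-corner element with coordinates `c`. -/
def IsTop (hd : d = r ^ m) (l : J → Fin d → (Fin m → ZMod r) →ₗ[ZMod r] ZMod r)
    (w : FreeGroup (Fin m)) (c : J → ZMod r) : Prop :=
  ∀ j, (phi hd (l j) w : Matrix (Fin (d + 1)) (Fin (d + 1)) (ZMod r)) = cor (c j)

lemma d_ne (hd : d = r ^ m) : d ≠ 0 := left_ne_zero_of_mul (dr_ne hd)

lemma IsTop.mul {hd : d = r ^ m} {l : J → Fin d → (Fin m → ZMod r) →ₗ[ZMod r] ZMod r}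
    {w w' : FreeGroup (Fin m)} {c c' : J → ZMod r} (h : IsTop hd l w c) (h' : IsTop hd l w' c') :
    IsTop hd l (w * w') (c + c') := by
  intro j
  rw [map_mul, Units.val_mul, h j, h' j, cor_mul (d_ne hd)]; rfl

lemma IsTop.one {hd : d = r ^ m} {l : J → Fin d → (Fin m → ZMod r) →ₗ[ZMod r] ZMod r} :
    IsTop hd l 1 0 := by
  intro j
  simp [cor_zero]

lemma IsTop.inv {hd : d = r ^ m} {l : J → Fin d → (Fin m → ZMod r) →ₗ[ZMod r] ZMod r}
    {w : FreeGroup (Fin m)} {c : J → ZMod r} (h : IsTop hd l w c) :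
    IsTop hd l w⁻¹ (-c) := by
  intro j
  rw [map_inv]
  apply Units.inv_eq_of_mul_eq_one_right
  rw [h j, cor_mul (d_ne hd)]
  simp [cor_zero]

lemma IsTop.pow {hd : d = r ^ m} {l : J → Fin d → (Fin m → ZMod r) →ₗ[ZMod r] ZMod r}
    {w : FreeGroup (Fin m)} {c : J → ZMod r} (h : IsTop hd l w c) (n : ℕ) :
    IsTop hd l (w ^ n) (n • c) := by
  induction n with
  | zero => simpa using IsTop.one
  | succ n ih => rw [pow_succ, succ_nsmul]; exact ih.mul h

lemma IsTop.conj {hd : d = r ^ m} {l : J → Fin d → (Fin m → ZMod r) →ₗ[ZMod r] ZMod r}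
    {w : FreeGroup (Fin m)} {c : J → ZMod r} (h : IsTop hd l w c) (g : FreeGroup (Fin m)) :
    IsTop hd l (g * w * g⁻¹) c := by
  intro j
  rw [map_mul, map_mul, Units.val_mul, Units.val_mul, h j, cor_comm (phi_UT hd (l j) g),
    mul_assoc, ← Units.val_mul, ← map_mul]
  simp

lemma IsTop.unique {hd : d = r ^ m} {l : J → Fin d → (Fin m → ZMod r) →ₗ[ZMod r] ZMod r}
    {w : FreeGroup (Fin m)} {c c' : J → ZMod r} (h : IsTop hd l w c) (h' : IsTop hd l w c') :
    c = c' := by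
  ext j
  have h1 := (h j).symm.trans (h' j)
  have h2 := congrFun (congrFun h1 0) (Fin.last d)
  simpa [cor] using h2

lemma isTop_pow (hd : d = r ^ m) (l : J → Fin d → (Fin m → ZMod r) →ₗ[ZMod r] ZMod r)
    (w : FreeGroup (Fin m)) :
    IsTop hd l (w ^ d) (fun j => ∏ k, l j k (ab m r w).toAdd) := by
  intro j
  rw [map_pow, Units.val_pow_eq_pow_val, (phi_UT hd (l j) w).pow_top hd]

/-- the subgroup -/
def Rsub (hd : d = r ^ m) (l : J → Fin d → (Fin m → ZMod r) →ₗ[ZMod r] ZMod r) :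
    Subgroup (FreeGroup (Fin m)) where
  carrier := {w | ∃ c, IsTop hd l w c ∧ ∑ j, c j = 0}
  mul_mem' := by
    rintro a b ⟨c, h, hc⟩ ⟨c', h', hc'⟩
    exact ⟨c + c', h.mul h', by simp [Finset.sum_add_distrib, hc, hc']⟩
  one_mem' := ⟨0, IsTop.one, by simp⟩
  inv_mem' := by
    rintro a ⟨c, h, hc⟩
    exact ⟨-c, h.inv, by simp [hc]⟩

lemma mem_Rsub (hd : d = r ^ m) (l : J → Fin d → (Fin m → ZMod r) →ₗ[ZMod r] ZMod r) (w) :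
    w ∈ Rsub hd l ↔ ∃ c, IsTop hd l w c ∧ ∑ j, c j = 0 := Iff.rfl

lemma Rsub_normal (hd : d = r ^ m) (l : J → Fin d → (Fin m → ZMod r) →ₗ[ZMod r] ZMod r) :
    (Rsub hd l).Normal := by
  refine ⟨?_⟩
  rintro w ⟨c, h, hc⟩ g
  exact ⟨c, h.conj g, hc⟩

lemma Rsub_finiteIndex (hd : d = r ^ m)
    (l : J → Fin d → (Fin m → ZMod r) →ₗ[ZMod r] ZMod r) :
    (Rsub hd l).FiniteIndex := by
  let Φ := MonoidHom.pi fun j => phi hd (l j)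
  have : NeZero r := ⟨(Fact.out : r.Prime).ne_zero⟩
  have hfin : Φ.ker.FiniteIndex := Subgroup.finiteIndex_ker Φ
  refine Subgroup.finiteIndex_of_le (H := Φ.ker) ?_
  intro w hw
  refine ⟨0, fun j => ?_, by simp⟩
  have : phi hd (l j) w = 1 := congrFun (MonoidHom.mem_ker.1 hw) j
  simp [this, cor_zero]

lemma Rsub_index (hd : d = r ^ m)
    (l : J → Fin d → (Fin m → ZMod r) →ₗ[ZMod r] ZMod r) :
    ∃ k : ℕ, (Rsub hd l).index = r ^ k := by
  have := Rsub_normal hd l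
  have := Rsub_finiteIndex hd l
  have hp : IsPGroup r (FreeGroup (Fin m) ⧸ Rsub hd l) := by
    intro g
    obtain ⟨w, rfl⟩ := QuotientGroup.mk_surjective g
    refine ⟨m + 1, ?_⟩
    rw [← QuotientGroup.mk_pow, QuotientGroup.eq_one_iff]
    refine ⟨0, fun j => ?_, by simp⟩
    rw [map_pow, Units.val_pow_eq_pow_val, pow_succ, ← hd, (phi_UT hd (l j) w).pow_eq_one hd]
    simp [cor_zero]
  exact IsPGroup.iff_card.1 hp

end group
end PrimHom

/-- Corollary 3.2 (free case): the primitive homology of a suitable normal cover of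
r-power index is a proper subspace. -/
theorem primitive_homology_free (m : ℕ) (hm : 2 ≤ m)
    (r : ℕ) (hr : r.Prime) (hodd : Odd r) :
    ∃ R : Subgroup (FreeGroup (Fin m)), R.Normal ∧ R.FiniteIndex ∧
      (∃ k : ℕ, R.index = r ^ k) ∧
      OHomology R {x | IsPrimitiveElement x} ≠ ⊤ := by
  classical
  have : Fact r.Prime := ⟨hr⟩
  obtain ⟨J, _, l, hl⟩ := PrimHom.exists_forms (ZMod r) (Fin m → ZMod r) (r ^ m) (by simp)
  have hd : r ^ m = r ^ m := rfl
  have hN := PrimHom.Rsub_normal hd l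
  refine ⟨PrimHom.Rsub hd l, hN, PrimHom.Rsub_finiteIndex hd l, PrimHom.Rsub_index hd l, ?_⟩
  have key : ∀ x : FreeGroup (Fin m), IsPrimitiveElement x →
      ∃ e c, PrimHom.IsTop hd l (x ^ e) c ∧ ∑ j, c j = 1 := by
    intro x hx
    have h1 := hl _ (PrimHom.ab_primitive (r := r) x hx)
    have h2 := PrimHom.isTop_pow hd l x
    set s := ∑ j, ∏ k, l j k (PrimHom.ab m r x).toAdd with hs
    refine ⟨r ^ m * (s⁻¹).val, _, by rw [pow_mul]; exact h2.pow _, ?_⟩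
    simp only [Pi.smul_apply, ← Finset.smul_sum]
    rw [← hs]
    simp [h1]
  have hprim : ∀ i : Fin m, IsPrimitiveElement (FreeGroup.of i) := fun i =>
    ⟨Fin m, FreeGroupBasis.ofFreeGroup (Fin m), i, by simp⟩
  obtain ⟨e0, c0, ht0, hc0⟩ := key _ (hprim ⟨0, by omega⟩)
  refine PrimHom.proper_of_central (PrimHom.Rsub hd l) _
    ((FreeGroup.of (⟨0, by omega⟩ : Fin m) ^ e0 : FreeGroup (Fin m)) :
      FreeGroup (Fin m) ⧸ PrimHom.Rsub hd l)
    ?_ ?_ ?_ ⟨0, by omega⟩ ⟨1, by omega⟩ (by simp) (hprim _)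
  · intro h
    rw [QuotientGroup.eq_one_iff] at h
    obtain ⟨c, hc, hc'⟩ := h
    rw [hc.unique ht0, hc0] at hc'
    exact one_ne_zero hc'
  · intro g
    obtain ⟨w, rfl⟩ := QuotientGroup.mk_surjective g
    rw [← QuotientGroup.mk_mul, ← QuotientGroup.mk_mul, eq_comm, QuotientGroup.eq]
    refine ⟨-c0 + c0, ?_, by simp⟩
    convert ht0.inv.mul (ht0.conj w) |>.conj w⁻¹ using 1
    group
  · intro x hx
    obtain ⟨e, c, ht, hc⟩ := key x hx
    refine ⟨e, ?_⟩
    rw [← QuotientGroup.mk_pow, QuotientGroup.eq]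
    exact ⟨-c + c0, ht.inv.mul ht0, by simp [Finset.sum_add_distrib, hc, hc0]⟩
end

section
/- Let g ≥ 2, let r be an odd prime, and let 𝒪 ⊆ π₁Σ_g be the set of elements that belong to some generating set of π₁Σ_g of cardinality 2g (a minimal generating set). Then there exists a finite-index normal subgroup R of π₁Σ_g whose index is a power of r and such that H₁^𝒪(R;ℚ) is a proper ℚ-subspace of H₁(R;ℚ) = Abelianization(R) ⊗_ℤ ℚ. -/
open scoped TensorProduct


/-- The surface relator `[x₁,y₁]⋯[x_g,y_g]`, with `xᵢ = (i, false)`, `yᵢ = (i, true)`. -/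
def surfaceRelator (g : ℕ) : FreeGroup (Fin g × Bool) :=
  (List.ofFn fun i : Fin g =>
    FreeGroup.of (i, false) * FreeGroup.of (i, true) *
      (FreeGroup.of (i, false))⁻¹ * (FreeGroup.of (i, true))⁻¹).prod

/-- The genus-`g` surface group. -/
def SurfaceGroup (g : ℕ) : Type :=
  PresentedGroup {surfaceRelator g}

instance (g : ℕ) : Group (SurfaceGroup g) :=
  inferInstanceAs (Group (PresentedGroup _))

/-- The standard generators of the surface group. -/
def surfaceGen (g : ℕ) (i : Fin g × Bool) : SurfaceGroup g :=
  PresentedGroup.of i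

lemma lift_surfaceRelator {G : Type} [CommGroup G] (g : ℕ) (f : Fin g × Bool → G) :
    FreeGroup.lift f (surfaceRelator g) = 1 := by
  rw [surfaceRelator, map_list_prod]
  refine List.prod_eq_one ?_
  intro x hx
  simp only [List.map_ofFn, List.mem_ofFn, Function.comp] at hx
  obtain ⟨i, rfl⟩ := hx
  simp [mul_comm, mul_assoc, mul_left_comm]

/-- The mod-`d` abelianization of the free group on `m` generators. -/
def freeModAb (m d : ℕ) : FreeGroup (Fin m) →* Multiplicative (Fin m → ZMod d) :=
  FreeGroup.lift fun i => Multiplicative.ofAdd (Pi.single i (1 : ZMod d))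

/-- The mod-`d` abelianization of the genus-`g` surface group. -/
def surfaceModAb (g d : ℕ) : SurfaceGroup g →* Multiplicative (Fin g × Bool → ZMod d) :=
  PresentedGroup.toGroup
    (f := fun i => Multiplicative.ofAdd (Pi.single i (1 : ZMod d)))
    (by intro r hr
        rw [Set.mem_singleton_iff] at hr
        subst hr
        exact lift_surfaceRelator _ _)

/-! ### Part 1: derivations and the homology of finite covers -/

/-- The affine permutation `u ↦ T u + m`. -/
def affPerm {M : Type} [AddCommGroup M] [Module ℂ M] (T : M ≃ₗ[ℂ] M) (m : M) : Equiv.Perm M :=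
  T.toEquiv.trans (Equiv.addRight m)

lemma affPerm_apply {M : Type} [AddCommGroup M] [Module ℂ M] (T : M ≃ₗ[ℂ] M) (m u : M) :
    affPerm T m u = T u + m := rfl

lemma affPerm_inv_apply {M : Type} [AddCommGroup M] [Module ℂ M] (T : M ≃ₗ[ℂ] M) (m u : M) :
    (affPerm T m)⁻¹ u = T⁻¹ u - T⁻¹ m := by
  rw [Equiv.Perm.inv_eq_iff_eq, affPerm_apply, ← map_sub]
  change u = T (T.symm _) + m
  simp

/-- The affine action of the free group determined by a linear action and translations. -/
def affHom {M ι : Type} [AddCommGroup M] [Module ℂ M] (θ : FreeGroup ι →* (M ≃ₗ[ℂ] M))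
    (m : ι → M) : FreeGroup ι →* Equiv.Perm M :=
  FreeGroup.lift fun t => affPerm (θ (FreeGroup.of t)) (m t)

lemma affHom_apply {M ι : Type} [AddCommGroup M] [Module ℂ M] (θ : FreeGroup ι →* (M ≃ₗ[ℂ] M))
    (m : ι → M) (w : FreeGroup ι) : ∀ u, affHom θ m w u = θ w u + affHom θ m w 0 := by
  induction w using FreeGroup.induction_on with
  | C1 => intro u; simp
  | of t => intro u; simp [affHom, affPerm_apply]
  | inv_of t _ =>
    intro u
    simp only [affHom, map_inv, FreeGroup.lift_apply_of, affPerm_inv_apply, map_zero]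
    abel
  | mul x y hx hy =>
    intro u
    rw [map_mul, map_mul, Equiv.Perm.mul_apply, Equiv.Perm.mul_apply, hx, hy u, map_add,
      hx (affHom θ m y 0), LinearEquiv.mul_apply]
    abel

lemma affHom_linear {M ι : Type} [AddCommGroup M] [Module ℂ M]
    (θ : FreeGroup ι →* (M ≃ₗ[ℂ] M)) (w : FreeGroup ι) :
    ∃ L : (ι → M) →ₗ[ℂ] M, ∀ m, affHom θ m w 0 = L m := by
  induction w using FreeGroup.induction_on with
  | C1 => exact ⟨0, fun m => by simp⟩
  | of t => exact ⟨LinearMap.proj t, fun m => by simp [affHom, affPerm_apply]⟩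
  | inv_of t _ =>
    refine ⟨-((θ (FreeGroup.of t))⁻¹.toLinearMap ∘ₗ LinearMap.proj t), fun m => ?_⟩
    simp [affHom, affPerm_inv_apply]
  | mul x y hx hy =>
    obtain ⟨Lx, hx⟩ := hx
    obtain ⟨Ly, hy⟩ := hy
    refine ⟨(θ x).toLinearMap ∘ₗ Ly + Lx, fun m => ?_⟩
    rw [map_mul, Equiv.Perm.mul_apply, affHom_apply, hx, hy]
    simp

/-- Existence of a derivation of the surface group which is not inner on generators. -/
lemma exists_derivation {M : Type} [AddCommGroup M] [Module ℂ M] [FiniteDimensional ℂ M]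
    [Nontrivial M] (g : ℕ) (hg : 2 ≤ g) (θ : SurfaceGroup g →* (M ≃ₗ[ℂ] M)) :
    ∃ D : SurfaceGroup g → M, (∀ x y, D (x * y) = D x + θ x (D y)) ∧
      ¬ ∃ u : M, ∀ x, D x = θ x u - u := by
  let q : FreeGroup (Fin g × Bool) →* SurfaceGroup g := PresentedGroup.mk {surfaceRelator g}
  have hq : q (surfaceRelator g) = 1 := by
    apply PresentedGroup.one_of_mem
    simp
  let θ' : FreeGroup (Fin g × Bool) →* (M ≃ₗ[ℂ] M) := θ.comp q
  obtain ⟨L, hL⟩ := affHom_linear θ' (surfaceRelator g)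
  let I : M →ₗ[ℂ] (Fin g × Bool → M) :=
    LinearMap.pi fun t => (θ' (FreeGroup.of t)).toLinearMap - LinearMap.id
  have hnot : ¬ LinearMap.ker L ≤ LinearMap.range I := by
    intro hle
    have h1 := Submodule.finrank_mono hle
    have h2 := LinearMap.finrank_range_le I
    have h3 := LinearMap.finrank_range_add_finrank_ker L
    have h4 := Submodule.finrank_le (LinearMap.range L)
    have h5 : Module.finrank ℂ (Fin g × Bool → M) = (g * 2) * Module.finrank ℂ M := by
      rw [Module.finrank_pi_fintype]; simp
    have h6 : 0 < Module.finrank ℂ M := Module.finrank_pos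
    nlinarith
  obtain ⟨m, hm, hmI⟩ := Set.not_subset.1 hnot
  have hrel : ∀ r ∈ ({surfaceRelator g} : Set (FreeGroup (Fin g × Bool))),
      FreeGroup.lift (fun t => affPerm (θ' (FreeGroup.of t)) (m t)) r = 1 := by
    intro r hr
    rw [Set.mem_singleton_iff] at hr
    subst hr
    ext u
    change affHom θ' m (surfaceRelator g) u = u
    have h0 : L m = 0 := hm
    rw [affHom_apply, hL, h0]
    simp [θ', hq]
  let Ψ : SurfaceGroup g →* Equiv.Perm M := PresentedGroup.toGroup hrel
  have hΨ : ∀ w, Ψ (q w) = affHom θ' m w := fun w => rfl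
  have hΨ2 : ∀ x u, Ψ x u = θ x u + Ψ x 0 := by
    intro x u
    obtain ⟨w, rfl⟩ := PresentedGroup.mk_surjective _ x
    exact affHom_apply θ' m w u
  refine ⟨fun x => Ψ x 0, ?_, ?_⟩
  · intro x y
    change Ψ (x * y) 0 = Ψ x 0 + θ x (Ψ y 0)
    rw [map_mul, Equiv.Perm.mul_apply, hΨ2, add_comm]
  · rintro ⟨u, hu⟩
    apply hmI
    refine ⟨u, ?_⟩
    ext t
    have := hu (q (FreeGroup.of t))
    simp only [hΨ] at this
    simp [affHom, affPerm_apply] at this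
    simp [I, this, θ']

/-- A derivation vanishing on the kernel of a map to a finite group is inner. -/
lemma derivation_inner {M π P : Type} [AddCommGroup M] [Module ℂ M] [Group π] [Group P] [Finite P]
    (φ : π →* P) (ρ : P →* (M ≃ₗ[ℂ] M)) (D : π → M)
    (hD : ∀ x y, D (x * y) = D x + ρ (φ x) (D y)) (h0 : ∀ x ∈ φ.ker, D x = 0) :
    ∃ u : M, ∀ x, D x = ρ (φ x) u - u := by
  classical
  have hfac : ∀ x y, φ x = φ y → D x = D y := by
    intro x y hxy
    have h1 : D (y * (y⁻¹ * x)) = D y + ρ (φ y) (D (y⁻¹ * x)) := hD _ _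
    rw [h0 (y⁻¹ * x) (by simp [MonoidHom.mem_ker, hxy])] at h1
    simpa using h1
  have := Fintype.ofFinite φ.range
  choose s hs using fun a : φ.range => a.2
  let S : M := ∑ a : φ.range, D (s a)
  have hS : ∀ x, S = (Fintype.card φ.range : ℂ) • D x + ρ (φ x) S := by
    intro x
    have e1 : S = ∑ a : φ.range, D (s ((⟨φ x, x, rfl⟩ : φ.range) * a)) :=
      (Equiv.sum_comp (Equiv.mulLeft (⟨φ x, x, rfl⟩ : φ.range)) fun a => D (s a)).symm
    have e2 : ∀ a : φ.range, D (s ((⟨φ x, x, rfl⟩ : φ.range) * a)) = D x + ρ (φ x) (D (s a)) := by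
      intro a
      rw [← hD]
      apply hfac
      rw [hs, map_mul, hs]
      rfl
    refine e1.trans ?_
    simp only [e2, Finset.sum_add_distrib, Finset.sum_const, Finset.card_univ]
    rw [map_sum, Nat.cast_smul_eq_nsmul]
  have hc : (Fintype.card φ.range : ℂ) ≠ 0 := by
    simp [Fintype.card_ne_zero]
  refine ⟨-((Fintype.card φ.range : ℂ)⁻¹ • S), fun x => ?_⟩
  have h := hS x
  have : (Fintype.card φ.range : ℂ) • D x = S - ρ (φ x) S := by
    rw [eq_sub_iff_add_eq]; exact h.symm
  rw [← inv_smul_smul₀ hc (D x), this, smul_sub, map_neg, map_smul]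
  abel

/-- If every element of `O` acts without fixed vectors on a nonzero representation of a finite
quotient, then the `O`-homology of the corresponding cover is proper. -/
theorem OHomology_ne_top_of_rep {M P : Type} [AddCommGroup M] [Module ℂ M] [Module ℚ M]
    [FiniteDimensional ℂ M] [Nontrivial M] [Group P] [Finite P] (g : ℕ) (hg : 2 ≤ g)
    (φ : SurfaceGroup g →* P) (ρ : P →* (M ≃ₗ[ℂ] M)) (O : Set (SurfaceGroup g))
    (hO : ∀ x ∈ O, ∀ u : M, ρ (φ x) u = u → u = 0) :
    OHomology φ.ker O ≠ ⊤ := by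
  obtain ⟨D, hD, hDn⟩ := exists_derivation g hg (ρ.comp φ)
  have hex : ∃ x ∈ φ.ker, D x ≠ 0 := by
    by_contra hcon
    push Not at hcon
    exact hDn (derivation_inner φ ρ D hD hcon)
  obtain ⟨x0, hx0, hDx0⟩ := hex
  have hD1 : D 1 = 0 := by
    have := hD 1 1
    simpa using this
  let f : φ.ker →* Multiplicative M :=
    { toFun := fun x => Multiplicative.ofAdd (D x)
      map_one' := by simp [hD1]
      map_mul' := by
        rintro ⟨x, hx⟩ ⟨y, hy⟩
        rw [MonoidHom.mem_ker] at hx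
        simp [hD, hx] }
  let f2 : Additive (Abelianization φ.ker) →+ M := MonoidHom.toAdditiveLeft (Abelianization.lift f)
  let f3 : ℚ ⊗[ℤ] Additive (Abelianization φ.ker) →ₗ[ℚ] M :=
    LinearMap.liftBaseChange ℚ f2.toIntLinearMap
  have hf3 : ∀ x : φ.ker, f3 ((1 : ℚ) ⊗ₜ[ℤ] Additive.ofMul (Abelianization.of x)) = D x := by
    intro x
    simp [f3, f2, f]
  intro htop
  have hle : OHomology φ.ker O ≤ LinearMap.ker f3 := by
    rw [OHomology, Submodule.span_le]
    rintro v ⟨x, hx, m, hm, rfl⟩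
    rw [SetLike.mem_coe, LinearMap.mem_ker, hf3]
    apply hO x hx
    have h1 : D (x * x ^ m) = D x + ρ (φ x) (D (x ^ m)) := hD _ _
    have h2 : D (x ^ m * x) = D (x ^ m) + ρ (φ (x ^ m)) (D x) := hD _ _
    rw [MonoidHom.mem_ker] at hm
    rw [hm, map_one, LinearEquiv.coe_one, id, ← zpow_add_one, add_comm m 1, zpow_add, zpow_one,
      h1, add_comm] at h2
    exact add_right_cancel h2
  rw [htop] at hle
  have : f3 ((1 : ℚ) ⊗ₜ[ℤ] Additive.ofMul (Abelianization.of (⟨x0, hx0⟩ : φ.ker))) = 0 :=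
    hle Submodule.mem_top
  rw [hf3] at this
  exact hDx0 this

/-! ### Part 2: induced representations and achievable functions -/

/-- The space of functions on `P` transforming under `Z` by the character attached to `χ`
(the representation of `P` induced from this character). -/
def indSpace {P : Type} [Group P] (p : ℕ) [NeZero p] (Z : Subgroup P)
    (χ : Z →* Multiplicative (ZMod p)) : Submodule ℂ (P → ℂ) where
  carrier := {f | ∀ (z : Z) (x : P), f (z * x) = ZMod.stdAddChar (χ z).toAdd * f x}
  add_mem' := by
    intro a b ha hb z x
    simp [ha z x, hb z x, mul_add]
  zero_mem' := by intro z x; simp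
  smul_mem' := by
    intro c a ha z x
    simp only [Pi.smul_apply, smul_eq_mul, ha z x]
    ring

/-- Right translation on the induced representation. -/
def indEnd {P : Type} [Group P] (p : ℕ) [NeZero p] (Z : Subgroup P)
    (χ : Z →* Multiplicative (ZMod p)) : P →* Module.End ℂ (indSpace p Z χ) where
  toFun a :=
    { toFun := fun f => ⟨fun x => f.1 (x * a), fun z x => by
        have h := f.2 z (x * a)
        rw [← mul_assoc] at h
        exact h⟩
      map_add' := fun _ _ => rfl
      map_smul' := fun _ _ => rfl }
  map_one' := by
    ext f x
    simp
  map_mul' := by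
    intro a b
    ext f x
    simp [mul_assoc]

/-- The induced representation. -/
def indRep {P : Type} [Group P] (p : ℕ) [NeZero p] (Z : Subgroup P)
    (χ : Z →* Multiplicative (ZMod p)) : P →* (indSpace p Z χ ≃ₗ[ℂ] indSpace p Z χ) :=
  (LinearMap.GeneralLinearGroup.generalLinearEquiv ℂ (indSpace p Z χ)).toMonoidHom.comp
    (MonoidHom.toHomUnits (indEnd p Z χ))

lemma indRep_apply {P : Type} [Group P] (p : ℕ) [NeZero p] (Z : Subgroup P)
    (χ : Z →* Multiplicative (ZMod p)) (a : P) (f : indSpace p Z χ) (x : P) :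
    (indRep p Z χ a f).1 x = f.1 (x * a) := rfl

lemma indSpace_nontrivial {P : Type} [Group P] (p : ℕ) [NeZero p] (Z : Subgroup P)
    (χ : Z →* Multiplicative (ZMod p)) : Nontrivial (indSpace p Z χ) := by
  classical
  let f : P → ℂ := fun x => if h : x ∈ Z then ZMod.stdAddChar (χ ⟨x, h⟩).toAdd else 0
  have hf : f ∈ indSpace p Z χ := by
    intro z x
    by_cases hx : x ∈ Z
    · have hzx : (z : P) * x ∈ Z := Z.mul_mem z.2 hx
      have : (⟨z * x, hzx⟩ : Z) = z * ⟨x, hx⟩ := rfl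
      simp only [f, hx, hzx, dif_pos, this, map_mul, toAdd_mul, AddChar.map_add_eq_mul]
    · have hzx : (z : P) * x ∉ Z := fun h => hx ((Z.mul_mem_cancel_left z.2).1 h)
      simp only [f, hx, hzx, dif_neg, not_false_eq_true, mul_zero]
  refine ⟨⟨f, hf⟩, 0, fun h => ?_⟩
  have h1 : f 1 = 0 := congrFun (congrArg Subtype.val h) 1
  have h2 : (⟨1, Z.one_mem⟩ : Z) = 1 := rfl
  simp only [f, Z.one_mem, dif_pos, h2, map_one, toAdd_one, AddChar.map_zero_eq_one] at h1
  exact one_ne_zero h1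

/-- Functions `h` on `H₁(π; ZMod p)` such that `x ^ d` maps, in some finite `p`-group quotient,
into a central subgroup with a character whose value on `x ^ d` is `h [x]`. -/
def Ach (g p d : ℕ) (h : (Fin g × Bool → ZMod p) → ZMod p) : Prop :=
  ∃ (P : Type) (_ : Group P) (φ : SurfaceGroup g →* P) (Z : Subgroup P)
    (χ : Z →* Multiplicative (ZMod p)), Finite P ∧ IsPGroup p P ∧ Z ≤ Subgroup.center P ∧
    ∀ x, ∃ hz : φ x ^ d ∈ Z, χ ⟨φ x ^ d, hz⟩ = Multiplicative.ofAdd (h (surfaceModAb g p x).toAdd)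

lemma surfaceModAb_gen (g p : ℕ) (t : Fin g × Bool) :
    surfaceModAb g p (surfaceGen g t) = Multiplicative.ofAdd (Pi.single t 1) :=
  PresentedGroup.toGroup.of _

lemma modAb_ne_zero (g p : ℕ) [Fact p.Prime] (S : Finset (SurfaceGroup g))
    (hS : S.card = 2 * g) (hcl : Subgroup.closure (S : Set (SurfaceGroup g)) = ⊤)
    (x : SurfaceGroup g) (hx : x ∈ S) : (surfaceModAb g p x).toAdd ≠ 0 := by
  classical
  intro h0
  let T : Finset (Fin g × Bool → ZMod p) := (S.erase x).image fun y => (surfaceModAb g p y).toAdd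
  have hT : T.card < 2 * g := by
    calc T.card ≤ (S.erase x).card := Finset.card_image_le
      _ < S.card := Finset.card_erase_lt_of_mem hx
      _ = 2 * g := hS
  have hmem : ∀ y, (surfaceModAb g p y).toAdd ∈ Submodule.span (ZMod p)
      (T : Set (Fin g × Bool → ZMod p)) := by
    intro y
    have hy : y ∈ Subgroup.closure (S : Set (SurfaceGroup g)) := by rw [hcl]; trivial
    induction hy using Subgroup.closure_induction with
    | mem y hy =>
      by_cases hyx : y = x
      · rw [hyx, h0]; exact zero_mem _
      · apply Submodule.subset_span
        simp only [T, Finset.coe_image]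
        exact ⟨y, by simp [hyx]; exact hy, rfl⟩
    | one => simp
    | mul a b _ _ ha hb => rw [map_mul, toAdd_mul]; exact add_mem ha hb
    | inv a _ ha => rw [map_inv, toAdd_inv]; exact neg_mem ha
  have htop : Submodule.span (ZMod p) (T : Set (Fin g × Bool → ZMod p)) = ⊤ := by
    rw [eq_top_iff, ← (Pi.basisFun (ZMod p) (Fin g × Bool)).span_eq, Submodule.span_le]
    rintro _ ⟨t, rfl⟩
    have := hmem (surfaceGen g t)
    rw [surfaceModAb_gen] at this
    simpa using this
  have h1 := finrank_span_finset_le_card (R := ZMod p) T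
  rw [Set.finrank, htop, finrank_top, Module.finrank_fintype_fun_eq_card] at h1
  simp at h1
  omega

/-- A nowhere vanishing achievable function yields the theorem. -/
theorem main_of_ach (g : ℕ) (hg : 2 ≤ g) (p : ℕ) [Fact p.Prime] (d : ℕ)
    (h : (Fin g × Bool → ZMod p) → ZMod p) (hach : Ach g p d h) (hne : ∀ v, v ≠ 0 → h v ≠ 0) :
    ∃ R : Subgroup (SurfaceGroup g), R.Normal ∧ R.FiniteIndex ∧
      (∃ k : ℕ, R.index = p ^ k) ∧
      OHomology R {x | ∃ S : Finset (SurfaceGroup g), S.card = 2 * g ∧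
        Subgroup.closure (S : Set (SurfaceGroup g)) = ⊤ ∧ x ∈ S} ≠ ⊤ := by
  obtain ⟨P, _, φ, Z, χ, hfin, hP, hZ, hφ⟩ := hach
  refine ⟨φ.ker, inferInstance, ?_, ?_, ?_⟩
  · exact Subgroup.finiteIndex_ker φ
  · obtain ⟨k, hk⟩ := IsPGroup.iff_card.1 (hP.to_subgroup φ.range)
    exact ⟨k, by rw [Subgroup.index_ker, hk]⟩
  · have := indSpace_nontrivial p Z χ
    apply OHomology_ne_top_of_rep g hg φ (indRep p Z χ)
    rintro x ⟨S, hS, hcl, hx⟩ u hu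
    obtain ⟨hz, hχ⟩ := hφ x
    have hv := hne _ (modAb_ne_zero g p S hS hcl x hx)
    have hpow : ∀ n : ℕ, indRep p Z χ (φ x ^ n) u = u := by
      intro n
      induction n with
      | zero => simp
      | succ n ih => rw [pow_succ, map_mul, LinearEquiv.mul_apply, hu, ih]
    have hd := hpow d
    ext y
    have h1 : u.1 (y * φ x ^ d) = u.1 y := by
      rw [← indRep_apply, hd]
    have hc : y * φ x ^ d = φ x ^ d * y := (Subgroup.mem_center_iff.1 (hZ hz) y)
    have h2 := u.2 ⟨φ x ^ d, hz⟩ y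
    rw [hχ, toAdd_ofAdd] at h2
    simp only at h2
    rw [hc, h2] at h1
    by_contra hy
    have h3 : ZMod.stdAddChar (h (surfaceModAb g p x).toAdd) = (1 : ℂ) :=
      mul_right_cancel₀ hy (h1.trans (one_mul _).symm)
    rw [← AddChar.map_zero_eq_one (ZMod.stdAddChar (N := p))] at h3
    exact hv (ZMod.injective_stdAddChar h3)

lemma Ach.add {g p d : ℕ} {h₁ h₂ : (Fin g × Bool → ZMod p) → ZMod p}
    (H₁ : Ach g p d h₁) (H₂ : Ach g p d h₂) : Ach g p d (h₁ + h₂) := by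
  obtain ⟨P₁, _, φ₁, Z₁, χ₁, hfin₁, hP₁, hZ₁, hφ₁⟩ := H₁
  obtain ⟨P₂, _, φ₂, Z₂, χ₂, hfin₂, hP₂, hZ₂, hφ₂⟩ := H₂
  refine ⟨P₁ × P₂, inferInstance, φ₁.prod φ₂, Z₁.prod Z₂,
    (χ₁.comp ((MonoidHom.fst _ _).comp (Z₁.prodEquiv Z₂).toMonoidHom)) *
    (χ₂.comp ((MonoidHom.snd _ _).comp (Z₁.prodEquiv Z₂).toMonoidHom)), inferInstance, ?_, ?_, ?_⟩
  · intro ⟨a, b⟩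
    obtain ⟨m, hm⟩ := hP₁ a
    obtain ⟨n, hn⟩ := hP₂ b
    refine ⟨m + n, ?_⟩
    ext
    · simp [pow_add, pow_mul, hm]
    · rw [add_comm]
      simp [pow_add, pow_mul, hn]
  · rintro ⟨a, b⟩ ⟨ha, hb⟩
    rw [Subgroup.mem_center_iff]
    rintro ⟨a', b'⟩
    ext
    · exact Subgroup.mem_center_iff.1 (hZ₁ ha) a'
    · exact Subgroup.mem_center_iff.1 (hZ₂ hb) b'
  · intro x
    obtain ⟨hz₁, e₁⟩ := hφ₁ x
    obtain ⟨hz₂, e₂⟩ := hφ₂ x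
    refine ⟨⟨hz₁, hz₂⟩, ?_⟩
    change χ₁ ⟨φ₁ x ^ d, hz₁⟩ * χ₂ ⟨φ₂ x ^ d, hz₂⟩ = _
    rw [e₁, e₂]
    rfl

lemma Ach.zero {g p d : ℕ} : Ach g p d 0 := by
  refine ⟨Unit, inferInstance, 1, ⊤, 1, inferInstance, ?_, ?_, ?_⟩
  · intro x; exact ⟨0, rfl⟩
  · intro x _; rw [Subgroup.mem_center_iff]; intro y; rfl
  · intro x
    refine ⟨trivial, rfl⟩

lemma Ach.smul {g p d : ℕ} {h : (Fin g × Bool → ZMod p) → ZMod p}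
    (c : ZMod p) (H : Ach g p d h) : Ach g p d (c • h) := by
  obtain ⟨P, _, φ, Z, χ, hfin, hP, hZ, hφ⟩ := H
  refine ⟨P, inferInstance, φ, Z,
    (AddMonoidHom.toMultiplicative (AddMonoidHom.mulLeft c)).comp χ, hfin, hP, hZ, ?_⟩
  intro x
  obtain ⟨hz, e⟩ := hφ x
  refine ⟨hz, ?_⟩
  rw [MonoidHom.comp_apply, e]
  rfl

/-- Achievable functions form a subspace. -/
def achSub (g p d : ℕ) : Submodule (ZMod p) ((Fin g × Bool → ZMod p) → ZMod p) where
  carrier := {h | Ach g p d h}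
  add_mem' := Ach.add
  zero_mem' := Ach.zero
  smul_mem' c _ H := Ach.smul c H

/-! ### Part 3: unitriangular matrices over `ZMod p` -/

/-- Square matrices of size `d + 1` over `ZMod p`. -/
abbrev Mat (p d : ℕ) : Type := Matrix (Fin (d + 1)) (Fin (d + 1)) (ZMod p)

/-- Matrices supported on entries `(i, j)` with `i + s ≤ j`. -/
def IsShift {p d : ℕ} (s : ℕ) (N : Mat p d) : Prop :=
  ∀ i j : Fin (d + 1), (j : ℕ) < i + s → N i j = 0

lemma IsShift.mono {p d s t : ℕ} {N : Mat p d} (h : IsShift s N) (hst : t ≤ s) : IsShift t N :=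
  fun i j hij => h i j (by omega)

lemma IsShift.add {p d s : ℕ} {A B : Mat p d} (hA : IsShift s A) (hB : IsShift s B) :
    IsShift s (A + B) := fun i j hij => by
  rw [Matrix.add_apply, hA i j hij, hB i j hij, add_zero]

lemma IsShift.neg {p d s : ℕ} {A : Mat p d} (hA : IsShift s A) : IsShift s (-A) :=
  fun i j hij => by rw [Matrix.neg_apply, hA i j hij, neg_zero]

lemma IsShift.mul {p d s t : ℕ} {A B : Mat p d} (hA : IsShift s A) (hB : IsShift t B) :
    IsShift (s + t) (A * B) := fun i j hij => by
  rw [Matrix.mul_apply]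
  apply Finset.sum_eq_zero
  intro l _
  by_cases hl : (l : ℕ) < i + s
  · rw [hA i l hl, zero_mul]
  · rw [hB l j (by omega), mul_zero]

lemma IsShift.one {p d : ℕ} : IsShift 0 (1 : Mat p d) := fun i j hij =>
  Matrix.one_apply_ne (by intro h; subst h; omega)

lemma IsShift.pow {p d : ℕ} {A : Mat p d} (hA : IsShift 1 A) (n : ℕ) : IsShift n (A ^ n) := by
  induction n with
  | zero => exact IsShift.one
  | succ n ih => rw [pow_succ]; exact ih.mul hA

lemma IsShift.eq_zero {p d s : ℕ} {A : Mat p d} (hA : IsShift s A) (hs : d < s) : A = 0 := by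
  ext i j
  exact hA i j (by omega)

lemma IsShift.mul_entry {p d s t : ℕ} {A B : Mat p d} (hA : IsShift s A) (hB : IsShift t B)
    (i l j : Fin (d + 1)) (hl : (l : ℕ) = i + s) (hj : (j : ℕ) = l + t) :
    (A * B) i j = A i l * B l j := by
  rw [Matrix.mul_apply]
  apply Finset.sum_eq_single l
  · intro b _ hb
    have hb' : (b : ℕ) ≠ l := fun h => hb (Fin.ext h)
    by_cases hl' : (b : ℕ) < i + s
    · rw [hA i b hl', zero_mul]
    · rw [hB b j (by omega), mul_zero]
  · intro h; exact absurd (Finset.mem_univ _) h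

/-- The `m`-th superdiagonal entry. -/
def supEntry {p d : ℕ} (A : Mat p d) (m : ℕ) : ZMod p :=
  if h : m < d then A ⟨m, by omega⟩ ⟨m + 1, by omega⟩ else 0

lemma IsShift.pow_entry {p d : ℕ} {A : Mat p d} (hA : IsShift 1 A) (n : ℕ) (hn : n ≤ d) :
    (A ^ n) ⟨0, by omega⟩ ⟨n, by omega⟩ = ∏ m ∈ Finset.range n, supEntry A m := by
  induction n with
  | zero => simp
  | succ n ih =>
    rw [pow_succ, (hA.pow n).mul_entry hA ⟨0, by omega⟩ ⟨n, by omega⟩ ⟨n + 1, by omega⟩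
      (by simp) rfl, ih (by omega), Finset.prod_range_succ]
    congr 1
    rw [supEntry, dif_pos (by omega)]

/-- The monoid of upper unitriangular matrices. -/
def utMonoid (p d : ℕ) : Submonoid (Mat p d) where
  carrier := {A | IsShift 1 (A - 1)}
  one_mem' := by
    intro i j _
    simp
  mul_mem' := by
    intro A B hA hB
    have : A * B - 1 = (A - 1) * (B - 1) + ((A - 1) + (B - 1)) := by noncomm_ring
    change IsShift 1 (A * B - 1)
    rw [this]
    exact ((hA.mul hB).mono (by omega)).add (hA.add hB)

/-- The group of upper unitriangular matrices. -/
abbrev UT (p d : ℕ) : Type := (utMonoid p d).units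

/-- The matrix of an element of the unitriangular group. -/
def UT.mat {p d : ℕ} (u : UT p d) : Mat p d := ((u : (Mat p d)ˣ) : Mat p d)

lemma UT.mat_mul {p d : ℕ} (u v : UT p d) : (u * v).mat = u.mat * v.mat := rfl

lemma UT.mat_one {p d : ℕ} : (1 : UT p d).mat = 1 := rfl

lemma UT.mat_pow {p d : ℕ} (u : UT p d) (n : ℕ) : (u ^ n).mat = u.mat ^ n := rfl

lemma UT.ext_mat {p d : ℕ} {u v : UT p d} (h : u.mat = v.mat) : u = v :=
  Subtype.ext (Units.ext h)

lemma UT.shift {p d : ℕ} (u : UT p d) : IsShift 1 (u.mat - 1) :=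
  ((Submonoid.mem_units_iff _ _).1 u.2).1

lemma pow_sub_one {p d : ℕ} [Fact p.Prime] (A : Mat p d) (n : ℕ) :
    A ^ (p ^ n) - 1 = (A - 1) ^ (p ^ n) := by
  have h := add_pow_expChar_pow_of_commute (p := p) n (Commute.one_right (A - 1))
  rw [sub_add_cancel, one_pow] at h
  rw [h, add_sub_cancel_right]

lemma ut_pow_eq_one {p k : ℕ} [hp : Fact p.Prime] {A : Mat p (p ^ k)} (hA : IsShift 1 (A - 1)) :
    A ^ (p ^ (k + 1)) = 1 := by
  rw [← sub_eq_zero, pow_sub_one]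
  exact (hA.pow _).eq_zero (Nat.pow_lt_pow_right hp.out.one_lt (by omega))

/-- The matrix with superdiagonal `c`. -/
def supMat (p d : ℕ) (c : ℕ → ZMod p) : Mat p d :=
  Matrix.of fun i j => if (j : ℕ) = i + 1 then c i else 0

lemma supMat_shift (p d : ℕ) (c : ℕ → ZMod p) : IsShift 1 (supMat p d c) := by
  intro i j hij
  simp only [supMat, Matrix.of_apply]
  rw [if_neg (by omega)]

lemma one_add_supMat_mem (p d : ℕ) (c : ℕ → ZMod p) : 1 + supMat p d c ∈ utMonoid p d := by
  change IsShift 1 (1 + supMat p d c - 1)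
  rw [add_sub_cancel_left]
  exact supMat_shift _ _ _

/-- The unitriangular matrix with superdiagonal `c`. -/
def uni (p k : ℕ) [hp : Fact p.Prime] (c : ℕ → ZMod p) : UT p (p ^ k) :=
  ⟨⟨1 + supMat p (p ^ k) c, (1 + supMat p (p ^ k) c) ^ (p ^ (k + 1) - 1), by
      rw [← pow_succ', Nat.sub_add_cancel (Nat.one_le_pow _ _ hp.out.pos)]
      exact ut_pow_eq_one (one_add_supMat_mem _ _ c), by
      rw [← pow_succ, Nat.sub_add_cancel (Nat.one_le_pow _ _ hp.out.pos)]
      exact ut_pow_eq_one (one_add_supMat_mem _ _ c)⟩, by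
    rw [Submonoid.mem_units_iff]
    exact ⟨one_add_supMat_mem _ _ c, Submonoid.pow_mem _ (one_add_supMat_mem _ _ c) _⟩⟩

lemma uni_mat (p k : ℕ) [Fact p.Prime] (c : ℕ → ZMod p) :
    (uni p k c).mat = 1 + supMat p (p ^ k) c := rfl

lemma supMat_mul_apply (p d : ℕ) (c c' : ℕ → ZMod p) (i j : Fin (d + 1)) :
    (supMat p d c * supMat p d c') i j = if (j : ℕ) = i + 2 then c i * c' (i + 1) else 0 := by
  by_cases h : (j : ℕ) = i + 2
  · rw [(supMat_shift p d c).mul_entry (supMat_shift p d c') i ⟨i + 1, by omega⟩ j rfl (by simp; omega)]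
    simp [supMat, h]
  · rw [if_neg h, Matrix.mul_apply]
    apply Finset.sum_eq_zero
    intro l _
    simp only [supMat, Matrix.of_apply]
    by_cases hl : (l : ℕ) = i + 1
    · rw [if_neg (by omega : ¬ (j : ℕ) = l + 1), mul_zero]
    · rw [if_neg hl, zero_mul]

lemma uni_commute (p k : ℕ) [Fact p.Prime] (c c' : ℕ → ZMod p)
    (h : ∀ m, c m * c' (m + 1) = c' m * c (m + 1)) : Commute (uni p k c) (uni p k c') := by
  apply UT.ext_mat
  rw [UT.mat_mul, UT.mat_mul, uni_mat, uni_mat]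
  have : supMat p (p ^ k) c * supMat p (p ^ k) c' = supMat p (p ^ k) c' * supMat p (p ^ k) c := by
    ext i j
    rw [supMat_mul_apply, supMat_mul_apply, h]
  simp only [mul_add, add_mul, mul_one, one_mul, this]
  abel

/-- The superdiagonal entries are additive. -/
def supHom (p d m : ℕ) : UT p d →* Multiplicative (ZMod p) where
  toFun u := Multiplicative.ofAdd (supEntry (u.mat - 1) m)
  map_one' := by
    rw [UT.mat_one, sub_self]
    simp [supEntry]
  map_mul' := by
    intro u v
    rw [← ofAdd_add, UT.mat_mul]
    congr 1
    by_cases hm : m < d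
    · simp only [supEntry, dif_pos hm]
      have : u.mat * v.mat - 1 = (u.mat - 1) * (v.mat - 1) + ((u.mat - 1) + (v.mat - 1)) := by
        noncomm_ring
      rw [this, Matrix.add_apply, Matrix.add_apply, (u.shift.mul v.shift) _ _ (by simp),
        zero_add]
    · simp [supEntry, hm]

lemma supHom_uni (p k m : ℕ) [Fact p.Prime] (c : ℕ → ZMod p) (hm : m < p ^ k) :
    supHom p (p ^ k) m (uni p k c) = Multiplicative.ofAdd (c m) := by
  change Multiplicative.ofAdd (supEntry ((uni p k c).mat - 1) m) = _
  rw [uni_mat, add_sub_cancel_left]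
  simp [supEntry, hm, supMat]

/-- The central corner subgroup. -/
def corner (p d : ℕ) : Subgroup (UT p d) where
  carrier := {u | IsShift d (u.mat - 1)}
  one_mem' := by
    intro i j _
    simp [UT.mat_one]
  mul_mem' := by
    intro u v hu hv
    have : (u * v).mat - 1 = u.mat * (v.mat - 1) + (u.mat - 1) := by
      rw [UT.mat_mul]; noncomm_ring
    have h0 : IsShift 0 u.mat := by
      have := (u.shift.mono (Nat.zero_le 1)).add IsShift.one
      rwa [sub_add_cancel] at this
    change IsShift d ((u * v).mat - 1)
    rw [this]
    have h1 := h0.mul hv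
    rw [zero_add] at h1
    exact h1.add hu
  inv_mem' := by
    intro u hu
    have h1 : (u⁻¹).mat * u.mat = 1 := by
      rw [← UT.mat_mul, inv_mul_cancel, UT.mat_one]
    have : (u⁻¹).mat - 1 = -((u⁻¹).mat * (u.mat - 1)) := by
      rw [mul_sub, h1]; noncomm_ring
    have h0 : IsShift 0 (u⁻¹).mat := by
      have := ((u⁻¹).shift.mono (Nat.zero_le 1)).add IsShift.one
      rwa [sub_add_cancel] at this
    change IsShift d ((u⁻¹).mat - 1)
    rw [this]
    have h1 := h0.mul hu
    rw [zero_add] at h1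
    exact h1.neg

/-- The corner entry as a homomorphism. -/
def cornerHom (p d : ℕ) (hd : 0 < d) : corner p d →* Multiplicative (ZMod p) where
  toFun u := Multiplicative.ofAdd ((u.1.mat - 1) ⟨0, by omega⟩ ⟨d, by omega⟩)
  map_one' := by
    simp [UT.mat_one]
  map_mul' := by
    intro u v
    rw [← ofAdd_add]
    congr 1
    have : (u * v).1.mat - 1 = (u.1.mat - 1) * (v.1.mat - 1) + ((u.1.mat - 1) + (v.1.mat - 1)) := by
      change u.1.mat * v.1.mat - 1 = _
      noncomm_ring
    have hu : IsShift d (u.1.mat - 1) := u.2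
    have hv : IsShift d (v.1.mat - 1) := v.2
    rw [this, Matrix.add_apply, Matrix.add_apply, (hu.mul hv) _ _ (by simp; omega), zero_add]

lemma corner_le_center (p d : ℕ) : corner p d ≤ Subgroup.center (UT p d) := by
  intro u hu
  rw [Subgroup.mem_center_iff]
  intro v
  have hu' : IsShift d (u.mat - 1) := hu
  apply UT.ext_mat
  rw [UT.mat_mul, UT.mat_mul, ← sub_eq_zero]
  have h1 := (hu'.mul v.shift).eq_zero (by omega)
  have h2 := (v.shift.mul hu').eq_zero (by omega)
  have : v.mat * u.mat - u.mat * v.mat = (v.mat - 1) * (u.mat - 1) - (u.mat - 1) * (v.mat - 1) := by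
    noncomm_ring
  rw [this, h1, h2, sub_zero]

/-- Products of linear forms satisfying the surface relation are achievable. -/
theorem ach_word (g p k : ℕ) [hp : Fact p.Prime] (w : ℕ → Fin g × Bool → ZMod p)
    (hrel : FreeGroup.lift (fun t => uni p k (fun m => w m t)) (surfaceRelator g) = 1) :
    Ach g p (p ^ k) (fun v => ∏ m ∈ Finset.range (p ^ k), ∑ t, w m t * v t) := by
  have hd : 0 < p ^ k := pow_pos hp.out.pos _
  have hrel' : ∀ r ∈ ({surfaceRelator g} : Set (FreeGroup (Fin g × Bool))),
      FreeGroup.lift (fun t => uni p k (fun m => w m t)) r = 1 := by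
    intro r hr
    rw [Set.mem_singleton_iff] at hr
    rw [hr, hrel]
  let φ : SurfaceGroup g →* UT p (p ^ k) := PresentedGroup.toGroup hrel'
  have hφ : ∀ m < p ^ k, ∀ x, supEntry ((φ x).mat - 1) m =
      ∑ t, w m t * (surfaceModAb g p x).toAdd t := by
    intro m hm
    let lin : Multiplicative (Fin g × Bool → ZMod p) →* Multiplicative (ZMod p) :=
      AddMonoidHom.toMultiplicative
        { toFun := fun v => ∑ t, w m t * v t
          map_zero' := by simp
          map_add' := by intro a b; simp [mul_add, Finset.sum_add_distrib] }
    have heq : (supHom p (p ^ k) m).comp φ = lin.comp (surfaceModAb g p) := by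
      apply PresentedGroup.ext
      intro t
      have h1 : φ (surfaceGen g t) = uni p k (fun m => w m t) := PresentedGroup.toGroup.of _
      change supHom p (p ^ k) m (φ (surfaceGen g t)) = lin (surfaceModAb g p (surfaceGen g t))
      rw [h1, surfaceModAb_gen, supHom_uni p k m _ hm]
      change _ = Multiplicative.ofAdd (∑ s, w m s * (Pi.single t (1 : ZMod p) : _ → ZMod p) s)
      congr 1
      simp [Pi.single_apply]
    intro x
    exact congrArg Multiplicative.toAdd (DFunLike.congr_fun heq x)
  refine ⟨UT p (p ^ k), inferInstance, φ, corner p (p ^ k), cornerHom p (p ^ k) hd, ?_, ?_,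
    corner_le_center _ _, ?_⟩
  · infer_instance
  · intro u
    refine ⟨k + 1, UT.ext_mat ?_⟩
    rw [UT.mat_pow, ut_pow_eq_one u.shift, UT.mat_one]
  · intro x
    have e : ((φ x) ^ p ^ k).mat - 1 = ((φ x).mat - 1) ^ p ^ k := by
      rw [UT.mat_pow, pow_sub_one]
    refine ⟨?_, ?_⟩
    · change IsShift _ _
      rw [e]
      exact (φ x).shift.pow _
    · change Multiplicative.ofAdd ((((φ x) ^ p ^ k).mat - 1) ⟨0, _⟩ ⟨p ^ k, _⟩) = _
      rw [e, (φ x).shift.pow_entry _ le_rfl]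
      congr 1
      apply Finset.prod_congr rfl
      intro m hm
      exact hφ m (Finset.mem_range.1 hm) x

/-! ### Part 4: words and monomials -/

/-- Letters which may be adjacent in a word: not the two distinct letters of one handle. -/
def compat {g : ℕ} (a b : Fin g × Bool) : Prop := a.1 = b.1 → a = b

lemma prod_getElem {g p : ℕ} (L : List (Fin g × Bool)) (v : Fin g × Bool → ZMod p) :
    ∏ m ∈ Finset.range L.length, (∑ t, (if L[m]? = some t then (1 : ZMod p) else 0) * v t)
      = (L.map v).prod := by
  induction L with
  | nil => simp
  | cons a L ih =>
    rw [List.length_cons, Finset.prod_range_succ', List.map_cons, List.prod_cons, mul_comm]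
    congr 1
    simp

lemma ach_list (g p k : ℕ) [Fact p.Prime] (L : List (Fin g × Bool)) (hL : L.IsChain compat)
    (hlen : L.length = p ^ k) : Ach g p (p ^ k) (fun v => (L.map v).prod) := by
  have key := ach_word g p k (fun m t => if L[m]? = some t then (1 : ZMod p) else 0) ?_
  · convert key using 2 with v
    rw [← hlen, prod_getElem]
  · rw [surfaceRelator, map_list_prod]
    refine List.prod_eq_one ?_
    intro x hx
    simp only [List.map_ofFn, List.mem_ofFn, Function.comp] at hx
    obtain ⟨i, rfl⟩ := hx
    simp only [map_mul, map_inv, FreeGroup.lift_apply_of]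
    rw [mul_inv_eq_one, mul_inv_eq_iff_eq_mul]
    apply uni_commute
    intro m
    have h0 : ∀ b : Bool, (if L[m]? = some (i, b) then (1 : ZMod p) else 0) *
        (if L[m + 1]? = some (i, !b) then (1 : ZMod p) else 0) = 0 := by
      intro b
      by_contra hne
      have h1 : L[m]? = some (i, b) := by
        by_contra h; simp [h] at hne
      have h2 : L[m + 1]? = some (i, !b) := by
        by_contra h; simp [h] at hne
      obtain ⟨l1, e1⟩ := List.getElem?_eq_some_iff.1 h1
      obtain ⟨l2, e2⟩ := List.getElem?_eq_some_iff.1 h2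
      have h3 := (List.isChain_iff_getElem.1 hL) m l2
      rw [e1, e2] at h3
      have := h3 rfl
      simp at this
    exact (h0 false).trans (h0 true).symm

lemma chain_rep {g : ℕ} {a b : Fin g × Bool} {M : List (Fin g × Bool)} (n : ℕ) (hab : compat a b)
    (hM : (b :: M).IsChain compat) : (a :: (List.replicate (n + 1) b ++ M)).IsChain compat := by
  induction n generalizing a with
  | zero => simpa using ⟨hab, hM⟩
  | succ n ih =>
    rw [List.replicate_succ, List.cons_append, List.isChain_cons_cons]
    exact ⟨hab, ih (fun _ => rfl)⟩

lemma exists_word {g p : ℕ} [hp : Fact p.Prime] (s s' : Fin g × Bool) (hs : s.1 ≠ s'.1)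
    (L₀ : List (Fin g × Bool)) : ∃ L : List (Fin g × Bool),
      (∀ M, (s :: M).IsChain compat → (s :: (L ++ M)).IsChain compat) ∧
      (∃ e, e ≤ 3 * L₀.length ∧ L.length = L₀.length + (p - 1) * e) ∧
      (∀ t ∈ L₀, t ∈ L) ∧
      ∀ v : Fin g × Bool → ZMod p, v s ≠ 0 → v s' ≠ 0 → (L.map v).prod = (L₀.map v).prod := by
  obtain ⟨q, hq⟩ : ∃ q, p - 1 = q + 1 := ⟨p - 2, by have := hp.out.two_le; omega⟩
  induction L₀ with
  | nil => exact ⟨[], fun M h => h, ⟨0, by simp, by simp⟩, by simp, by simp⟩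
  | cons t L₀ ih =>
    obtain ⟨L, h1, ⟨e, he, hl⟩, h3, h4⟩ := ih
    by_cases ht : t.1 = s.1
    · refine ⟨List.replicate (p - 1) s' ++ ([t] ++ (List.replicate (p - 1) s' ++
        (List.replicate (p - 1) s ++ L))), ?_, ⟨e + 3, ?_, ?_⟩, ?_, ?_⟩
      · intro M hM
        simp only [List.append_assoc, hq]
        apply chain_rep _ (fun h => absurd h hs)
        rw [List.singleton_append, List.isChain_cons_cons]
        refine ⟨fun h => absurd (h.trans ht).symm hs, ?_⟩
        apply chain_rep _ (fun h => absurd (ht.symm.trans h) hs)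
        apply chain_rep _ (fun h => absurd h.symm hs)
        exact h1 M hM
      · simp; omega
      · simp [hl]; ring
      · intro x hx
        rcases List.mem_cons.1 hx with rfl | hx
        · simp
        · simp [h3 x hx]
      · intro v hv hv'
        simp [h4 v hv hv', ZMod.pow_card_sub_one_eq_one hv, ZMod.pow_card_sub_one_eq_one hv']
    · refine ⟨[t] ++ (List.replicate (p - 1) s ++ L), ?_, ⟨e + 1, ?_, ?_⟩, ?_, ?_⟩
      · intro M hM
        simp only [List.append_assoc, hq]
        rw [List.singleton_append, List.isChain_cons_cons]
        refine ⟨fun h => absurd h.symm ht, ?_⟩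
        apply chain_rep _ (fun h => absurd h ht)
        exact h1 M hM
      · simp; omega
      · simp [hl]; ring
      · intro x hx
        rcases List.mem_cons.1 hx with rfl | hx
        · simp
        · simp [h3 x hx]
      · intro v hv hv'
        simp [h4 v hv hv', ZMod.pow_card_sub_one_eq_one hv]

lemma ach_mixed (g p k : ℕ) [hp : Fact p.Prime] (hk : 8 * g * p ^ 2 ≤ p ^ k)
    (L₀ : List (Fin g × Bool)) (s s' : Fin g × Bool) (hs : s.1 ≠ s'.1) (hsm : s ∈ L₀)
    (hsm' : s' ∈ L₀) (hlen : L₀.length ≤ 2 * g * p) (hdvd : p - 1 ∣ (p - 2) + L₀.length) :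
    Ach g p (p ^ k) (fun v => (L₀.map v).prod) := by
  have h2 := hp.out.two_le
  obtain ⟨L, h1, ⟨e, he, hl⟩, h3, h4⟩ := exists_word (p := p) s s' hs L₀
  have hle : L.length ≤ p ^ k := by
    obtain ⟨q, rfl⟩ : ∃ q, p = q + 1 := ⟨p - 1, by omega⟩
    rw [hl, Nat.add_sub_cancel]
    have a1 : q * e ≤ q * (3 * L₀.length) := Nat.mul_le_mul_left _ he
    have a2 : L₀.length * (q + 1) ≤ 2 * g * (q + 1) * (q + 1) := Nat.mul_le_mul_right _ hlen
    nlinarith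
  have hr : p - 1 ∣ p ^ k - L.length := by
    have b1 : p - 1 ∣ p ^ k - 1 := by simpa using Nat.sub_dvd_pow_sub_pow p 1 k
    have b2 : p - 1 ∣ (p - 2) + L.length := by
      rw [hl, ← add_assoc]; exact (Nat.dvd_add_right hdvd).2 (dvd_mul_right _ _)
    have b3 : (p ^ k - 1) + (p - 1) = (p ^ k - L.length) + ((p - 2) + L.length) := by
      have := Nat.one_le_pow k p (by omega)
      omega
    have b4 : p - 1 ∣ (p ^ k - L.length) + ((p - 2) + L.length) := by
      rw [← b3]; exact dvd_add b1 dvd_rfl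
    exact (Nat.dvd_add_left b2).1 b4
  obtain ⟨c, hc⟩ := hr
  have hch : (L ++ List.replicate (p ^ k - L.length) s).IsChain compat := by
    have : (s :: List.replicate (p ^ k - L.length) s).IsChain compat := by
      rw [← List.replicate_succ]
      exact List.isChain_replicate_of_rel _ (fun _ => rfl)
    exact (h1 _ this).tail
  have key := ach_list g p k _ hch (by simp; omega)
  convert key using 2 with v
  by_cases hv : v s = 0
  · rw [List.prod_eq_zero, List.prod_eq_zero]
    · rw [← hv]; exact List.mem_map_of_mem (by simp [h3 s hsm])
    · rw [← hv]; exact List.mem_map_of_mem hsm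
  by_cases hv' : v s' = 0
  · rw [List.prod_eq_zero, List.prod_eq_zero]
    · rw [← hv']; exact List.mem_map_of_mem (by simp [h3 s' hsm'])
    · rw [← hv']; exact List.mem_map_of_mem hsm'
  rw [List.map_append, List.prod_append, h4 v hv hv', List.map_replicate, List.prod_replicate, hc,
    pow_mul, ZMod.pow_card_sub_one_eq_one hv, one_pow, mul_one]

/-- Restriction of a vector to one handle. -/
def handle {g p : ℕ} (i : Fin g) (v : Fin g × Bool → ZMod p) : Fin g × Bool → ZMod p :=
  fun t => if t.1 = i then v t else 0

/-- Projection to homogeneous functions. -/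
def projE (g p : ℕ) [Fact p.Prime] : ((Fin g × Bool → ZMod p) → ZMod p) →ₗ[ZMod p]
    ((Fin g × Bool → ZMod p) → ZMod p) where
  toFun u v := -∑ c : (ZMod p)ˣ, (c : ZMod p) ^ (p - 2) * u ((c : ZMod p) • v)
  map_add' u u' := by
    ext v; simp [mul_add, Finset.sum_add_distrib]; ring
  map_smul' a u := by
    ext v
    simp only [Pi.smul_apply, smul_eq_mul, RingHom.id_apply, mul_neg, Finset.mul_sum, neg_inj]
    apply Finset.sum_congr rfl
    intro c _
    ring

/-- Projection to functions vanishing on all handles. -/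
def projT (g p : ℕ) : ((Fin g × Bool → ZMod p) → ZMod p) →ₗ[ZMod p]
    ((Fin g × Bool → ZMod p) → ZMod p) where
  toFun u v := u v - ∑ i : Fin g, u (handle i v) + ((g : ZMod p) - 1) * u 0
  map_add' u u' := by
    ext v; simp [Finset.sum_add_distrib]; ring
  map_smul' a u := by
    ext v
    simp only [Pi.smul_apply, smul_eq_mul, RingHom.id_apply, ← Finset.mul_sum]
    ring

/-- The monomial function attached to a list of letters. -/
def mono {g : ℕ} (p : ℕ) (L : List (Fin g × Bool)) (v : Fin g × Bool → ZMod p) : ZMod p :=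
  (L.map v).prod

lemma projE_mono (g p : ℕ) [Fact p.Prime] (L : List (Fin g × Bool)) :
    projE g p (mono p L) = if p - 1 ∣ (p - 2) + L.length then mono p L else 0 := by
  ext v
  have hsm : ∀ c : ZMod p, mono p L (c • v) = c ^ L.length * mono p L v := by
    intro c
    unfold mono
    induction L with
    | nil => simp
    | cons a L ih => simp only [List.map_cons, List.prod_cons, List.length_cons, ih]; simp; ring
  change -∑ c : (ZMod p)ˣ, (c : ZMod p) ^ (p - 2) * mono p L ((c : ZMod p) • v) = _
  simp only [hsm, ← mul_assoc, ← pow_add]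
  rw [← Finset.sum_mul, FiniteField.sum_pow_units, ZMod.card]
  split_ifs <;> simp

lemma mono_zero {g p : ℕ} (L : List (Fin g × Bool)) (v : Fin g × Bool → ZMod p)
    (t : Fin g × Bool) (ht : t ∈ L) (hv : v t = 0) : mono p L v = 0 := by
  unfold mono
  apply List.prod_eq_zero
  rw [← hv]; exact List.mem_map_of_mem ht

lemma projT_mono_mixed (g p : ℕ) (L : List (Fin g × Bool)) (s s' : Fin g × Bool)
    (hs : s.1 ≠ s'.1) (hsm : s ∈ L) (hsm' : s' ∈ L) : projT g p (mono p L) = mono p L := by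
  ext v
  change mono p L v - ∑ i : Fin g, mono p L (handle i v) + ((g : ZMod p) - 1) * mono p L 0 = _
  rw [mono_zero L 0 s hsm rfl, Finset.sum_eq_zero]
  · ring
  · intro i _
    by_cases h : s.1 = i
    · exact mono_zero L _ s' hsm' (by rw [handle, if_neg]; rw [← h]; exact hs.symm)
    · exact mono_zero L _ s hsm (by rw [handle, if_neg h])

lemma projT_mono_not_mixed (g p : ℕ) (L : List (Fin g × Bool))
    (h : ∀ s ∈ L, ∀ s' ∈ L, s.1 = s'.1) : projT g p (mono p L) = 0 := by
  ext v
  change mono p L v - ∑ i : Fin g, mono p L (handle i v) + ((g : ZMod p) - 1) * mono p L 0 = 0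
  rcases L with _ | ⟨a, L⟩
  · simp [mono]
  · have ha : a ∈ a :: L := by simp
    rw [mono_zero _ 0 a ha rfl, Finset.sum_eq_single a.1]
    · have : mono p (a :: L) (handle a.1 v) = mono p (a :: L) v := by
        unfold mono
        congr 1
        apply List.map_congr_left
        intro b hb
        rw [handle, if_pos (h b hb a ha)]
      rw [this]; ring
    · intro i _ hi
      exact mono_zero _ _ a ha (by rw [handle, if_neg hi.symm])
    · intro hh; exact absurd (Finset.mem_univ _) hh

lemma ach_proj_mono (g p k : ℕ) [hp : Fact p.Prime] (hk : 8 * g * p ^ 2 ≤ p ^ k)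
    (L : List (Fin g × Bool)) (hlen : L.length ≤ 2 * g * p) :
    projT g p (projE g p (mono p L)) ∈ achSub g p (p ^ k) := by
  rw [projE_mono]
  split_ifs with hd
  · by_cases h : ∀ s ∈ L, ∀ s' ∈ L, s.1 = s'.1
    · rw [projT_mono_not_mixed g p L h]; exact zero_mem _
    · push Not at h
      obtain ⟨s, hs, s', hs', hne⟩ := h
      rw [projT_mono_mixed g p L s s' hne hs hs']
      exact ach_mixed g p k hk L s s' hne hs hs' hlen hd
  · rw [map_zero]; exact zero_mem _

/-- Every function, once projected, is achievable. -/
lemma ach_proj (g p k : ℕ) [hp : Fact p.Prime] (hk : 8 * g * p ^ 2 ≤ p ^ k)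
    (u : (Fin g × Bool → ZMod p) → ZMod p) :
    projT g p (projE g p u) ∈ achSub g p (p ^ k) := by
  have htop := MvPolynomial.map_restrict_dom_evalₗ (ZMod p) (Fin g × Bool)
  have hu : u ∈ (MvPolynomial.restrictDegree (Fin g × Bool) (ZMod p)
      (Fintype.card (ZMod p) - 1)).map (MvPolynomial.evalₗ (ZMod p) (Fin g × Bool)) := by
    rw [htop]; trivial
  obtain ⟨P, hP, rfl⟩ := hu
  rw [SetLike.mem_coe, MvPolynomial.mem_restrictDegree, ZMod.card] at hP
  rw [← MvPolynomial.support_sum_monomial_coeff P, map_sum, map_sum, map_sum]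
  apply Submodule.sum_mem
  intro m hm
  have hmono : MvPolynomial.evalₗ (ZMod p) (Fin g × Bool)
      (MvPolynomial.monomial m (MvPolynomial.coeff m P)) =
      MvPolynomial.coeff m P • mono p (Finsupp.toMultiset m).toList := by
    ext v
    rw [MvPolynomial.evalₗ_apply, MvPolynomial.eval_monomial, Pi.smul_apply, smul_eq_mul]
    congr 1
    unfold mono
    rw [← Multiset.prod_coe, ← Multiset.map_coe, Multiset.coe_toList, Finsupp.toMultiset_map,
      Finsupp.prod_toMultiset, Finsupp.prod_mapDomain_index (by simp) (by intros; rw [pow_add])]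
  rw [hmono, map_smul, map_smul]
  apply Submodule.smul_mem
  apply ach_proj_mono g p k hk
  rw [Multiset.length_toList, Finsupp.card_toMultiset, Finsupp.sum_fintype _ _ (by simp)]
  calc ∑ t, m t ≤ ∑ _t : Fin g × Bool, p := Finset.sum_le_sum fun t _ =>
        (hP m hm t).trans (Nat.sub_le _ _)
    _ = 2 * g * p := by simp [mul_comm g 2]

lemma ach_vanish (g p k : ℕ) [hp : Fact p.Prime] (hk : 8 * g * p ^ 2 ≤ p ^ k)
    (u : (Fin g × Bool → ZMod p) → ZMod p)
    (hom : ∀ (c : (ZMod p)ˣ) v, u ((c : ZMod p) • v) = c * u v)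
    (hv : ∀ i v, u (handle i v) = 0) (h0 : u 0 = 0) : u ∈ achSub g p (p ^ k) := by
  have h2 := hp.out.two_le
  have hE : projE g p u = u := by
    ext v
    change -∑ c : (ZMod p)ˣ, (c : ZMod p) ^ (p - 2) * u ((c : ZMod p) • v) = _
    have : ∀ c : (ZMod p)ˣ, (c : ZMod p) ^ (p - 2) * u ((c : ZMod p) • v) = u v := by
      intro c
      rw [hom, ← mul_assoc, ← pow_succ, show p - 2 + 1 = p - 1 by omega,
        ZMod.pow_card_sub_one_eq_one c.ne_zero, one_mul]
    simp only [this, Finset.sum_const, Finset.card_univ, ZMod.card_units]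
    rw [nsmul_eq_mul, Nat.cast_sub (by omega)]
    simp
  have hT : projT g p u = u := by
    ext v
    change u v - ∑ i : Fin g, u (handle i v) + ((g : ZMod p) - 1) * u 0 = _
    simp [hv, h0]
  have := ach_proj g p k hk u
  rwa [hE, hT] at this

/-! ### Part 5: free quotients, and the conclusion -/

lemma uni_zero (p k : ℕ) [Fact p.Prime] : uni p k (fun _ => 0) = 1 := by
  apply UT.ext_mat
  rw [uni_mat, UT.mat_one]
  have : supMat p (p ^ k) (fun _ => 0) = 0 := by
    ext i j
    simp [supMat]
  rw [this, add_zero]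

/-- Functions coming from the quotient map to a free group of rank two which uses the two
handles `0` and `j`. -/
lemma ach_pair (g p k : ℕ) [Fact p.Prime] (i j : Fin g) (hij : i ≠ j) (α β : ℕ → ZMod p) :
    Ach g p (p ^ k) (fun v => ∏ m ∈ Finset.range (p ^ k),
      (α m * (v (i, false) + v (j, true)) + β m * (v (i, true) + v (j, false)))) := by
  have key := ach_word g p k (fun m t =>
    (if t = (i, false) then α m else 0) + (if t = (j, true) then α m else 0) +
    ((if t = (i, true) then β m else 0) + (if t = (j, false) then β m else 0))) ?_
  · convert key using 2 with v
    apply Finset.prod_congr rfl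
    intro m _
    simp only [add_mul, ite_mul, zero_mul, Finset.sum_add_distrib, Finset.sum_ite_eq',
      Finset.sum_ite_eq, Finset.mem_univ, if_true]
    ring
  · rw [surfaceRelator, map_list_prod, List.map_ofFn]
    let A := uni p k α
    let B := uni p k β
    let C := A * B * A⁻¹ * B⁻¹
    let e : Fin g → ℤ := fun l => (if l = i then 1 else 0) + (if l = j then -1 else 0)
    have hC : ∀ l, (⇑(FreeGroup.lift fun t => uni p k fun m =>
        (if t = (i, false) then α m else 0) + (if t = (j, true) then α m else 0) +
        ((if t = (i, true) then β m else 0) + (if t = (j, false) then β m else 0))) ∘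
        fun i : Fin g => FreeGroup.of (i, false) * FreeGroup.of (i, true) *
      (FreeGroup.of (i, false))⁻¹ * (FreeGroup.of (i, true))⁻¹) l =
        zpowersHom _ C (Multiplicative.ofAdd (e l)) := by
      intro l
      simp only [Function.comp, map_mul, map_inv, FreeGroup.lift_apply_of, Prod.mk.injEq]
      by_cases h1 : l = i
      · subst h1
        simp [hij, e, C, A, B]
      · by_cases h2 : l = j
        · subst h2
          simp [hij.symm, e, C, A, B, mul_assoc]
        · simp [h1, h2, e, uni_zero]
    rw [funext hC]
    have : (fun l => zpowersHom _ C (Multiplicative.ofAdd (e l))) =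
        (zpowersHom _ C) ∘ (fun l => Multiplicative.ofAdd (e l)) := rfl
    rw [this, ← List.map_ofFn, ← map_list_prod, List.prod_ofFn, ← ofAdd_sum]
    have hs : ∑ l, e l = 0 := by
      simp [e, Finset.sum_add_distrib]
    rw [hs, ofAdd_zero, map_one]

lemma ach_pair_mem (g p k : ℕ) [Fact p.Prime] (i j : Fin g) (hij : i ≠ j) (α β : ℕ → ZMod p) :
    (fun v => ∏ m ∈ Finset.range (p ^ k),
      (α m * (v (i, false) + v (j, true)) + β m * (v (i, true) + v (j, false))))
      ∈ achSub g p (p ^ k) :=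
  ach_pair g p k i j hij α β

/-- A nonvanishing homogeneous function of two variables. -/
def f0 (p k : ℕ) (S T : ZMod p) : ZMod p := S ^ p ^ k + T ^ p ^ k - S ^ (p ^ k - 1) * T

lemma f0_ne (p k : ℕ) [hp : Fact p.Prime] (hk : 1 ≤ k) (S T : ZMod p) (h : S ≠ 0 ∨ T ≠ 0) :
    f0 p k S T ≠ 0 := by
  have hd : 1 < p ^ k := Nat.one_lt_pow (by omega) hp.out.one_lt
  unfold f0
  rw [ZMod.pow_card_pow, ZMod.pow_card_pow]
  by_cases hS : S = 0
  · subst hS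
    rw [zero_pow (by omega)]
    simpa using h
  · have : S ^ (p ^ k - 1) = 1 := by
      have h1 : p - 1 ∣ p ^ k - 1 := by simpa using Nat.sub_dvd_pow_sub_pow p 1 k
      obtain ⟨c, hc⟩ := h1
      rw [hc, pow_mul, ZMod.pow_card_sub_one_eq_one hS, one_pow]
    rw [this]
    simpa using hS

lemma f0_zero (p k : ℕ) [hp : Fact p.Prime] : f0 p k 0 0 = 0 := by
  have hd : p ^ k ≠ 0 := pow_ne_zero _ hp.out.ne_zero
  simp [f0, hd]

lemma f0_smul (p k : ℕ) [hp : Fact p.Prime] (c S T : ZMod p) :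
    f0 p k (c * S) (c * T) = c * f0 p k S T := by
  have hd : 0 < p ^ k := pow_pos hp.out.pos _
  have h1 : c ^ (p ^ k - 1) * c = c := by
    rw [← pow_succ, Nat.sub_add_cancel hd, ZMod.pow_card_pow]
  unfold f0
  simp only [mul_pow, ZMod.pow_card_pow]
  linear_combination (-S ^ (p ^ k - 1) * T) * h1

lemma ach_f0 (g p k : ℕ) [hp : Fact p.Prime] (i j : Fin g) (hij : i ≠ j) :
    (fun v => f0 p k (v (i, false) + v (j, true)) (v (i, true) + v (j, false)))
      ∈ achSub g p (p ^ k) := by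
  have hd : 0 < p ^ k := pow_pos hp.out.pos _
  have a1 := ach_pair_mem g p k i j hij (fun _ => 1) (fun _ => 0)
  have a2 := ach_pair_mem g p k i j hij (fun _ => 0) (fun _ => 1)
  have a3 := ach_pair_mem g p k i j hij (fun m => if m = 0 then 0 else 1)
    (fun m => if m = 0 then 1 else 0)
  convert sub_mem (add_mem a1 a2) a3 using 1
  ext v
  obtain ⟨n, hn⟩ : ∃ n, p ^ k = n + 1 := ⟨p ^ k - 1, by omega⟩
  simp only [Pi.sub_apply, Pi.add_apply, f0, hn, Nat.add_sub_cancel]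
  rw [Finset.prod_range_succ' (fun m => (if m = 0 then (0 : ZMod p) else 1) * _ + _)]
  simp

lemma exists_coeff (g p : ℕ) [hp : Fact p.Prime] (hodd : Odd p) (i₀ i₁ : Fin g) (h : i₁ ≠ i₀) :
    ∃ c : Fin g → ZMod p, (∀ j, c j ≠ 0) ∧ ∑ j ∈ Finset.univ.erase i₀, c j ≠ 0 := by
  by_cases hs : ∑ j ∈ Finset.univ.erase i₀, (1 : ZMod p) = 0
  · refine ⟨fun j => 1 + if j = i₁ then 1 else 0, ?_, ?_⟩
    · intro j
      dsimp only
      split_ifs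
      · intro h2
        have h3 : ((2 : ℕ) : ZMod p) = 0 := by
          push_cast; rw [← h2]; norm_num
        rw [ZMod.natCast_eq_zero_iff] at h3
        have h4 := Nat.le_of_dvd (by norm_num) h3
        have h5 := hp.out.two_le
        have h6 : p = 2 := by omega
        subst h6
        exact absurd hodd (by decide)
      · simp
    · rw [Finset.sum_add_distrib, hs, Finset.sum_ite_eq', if_pos (by simp [h])]
      simp
  · exact ⟨fun _ => 1, fun _ => one_ne_zero, hs⟩

theorem exists_ach (g : ℕ) (hg : 2 ≤ g) (p : ℕ) [hp : Fact p.Prime] (hodd : Odd p) :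
    ∃ (d : ℕ) (h : (Fin g × Bool → ZMod p) → ZMod p), Ach g p d h ∧ ∀ v, v ≠ 0 → h v ≠ 0 := by
  classical
  let k := 8 * g * p ^ 2 + 1
  have hk : 8 * g * p ^ 2 ≤ p ^ k := by
    have := Nat.lt_pow_self (n := k) hp.out.one_lt
    omega
  have hk1 : 1 ≤ k := by omega
  clear_value k
  let i₀ : Fin g := ⟨0, by omega⟩
  let i₁ : Fin g := ⟨1, by omega⟩
  have h10 : i₁ ≠ i₀ := by simp [i₀, i₁]
  clear_value i₀ i₁
  obtain ⟨c, hc, hcs⟩ := exists_coeff g p hodd i₀ i₁ h10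
  let h₀ : (Fin g × Bool → ZMod p) → ZMod p := fun v => ∑ j ∈ Finset.univ.erase i₀,
    c j * f0 p k (v (i₀, false) + v (j, true)) (v (i₀, true) + v (j, false))
  have hh₀ : h₀ ∈ achSub g p (p ^ k) := by
    have : h₀ = ∑ j ∈ Finset.univ.erase i₀, c j •
        fun v : Fin g × Bool → ZMod p =>
          f0 p k (v (i₀, false) + v (j, true)) (v (i₀, true) + v (j, false)) := by
      ext v
      simp [h₀, Finset.sum_apply]
    rw [this]
    apply Submodule.sum_mem
    intro j hj
    apply Submodule.smul_mem
    exact ach_f0 g p k i₀ j (Finset.ne_of_mem_erase hj).symm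
  have hom₀ : ∀ (a : ZMod p) v, h₀ (a • v) = a * h₀ v := by
    intro a v
    simp only [h₀, Pi.smul_apply, smul_eq_mul, ← mul_add, f0_smul, Finset.mul_sum]
    apply Finset.sum_congr rfl
    intro j _
    ring
  -- nonvanishing on handles
  have hne₀ : ∀ i v, handle i v ≠ 0 → h₀ (handle i v) ≠ 0 := by
    intro i v hv
    have hcoord : v (i, false) ≠ 0 ∨ v (i, true) ≠ 0 := by
      by_contra hcon
      push Not at hcon
      apply hv
      ext ⟨l, b⟩
      by_cases hl : l = i
      · subst hl
        cases b <;> simp [handle, hcon.1, hcon.2]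
      · simp [handle, hl]
    by_cases hi : i = i₀
    · subst hi
      have : h₀ (handle i v) = (∑ j ∈ Finset.univ.erase i, c j) *
          f0 p k (v (i, false)) (v (i, true)) := by
        rw [Finset.sum_mul]
        apply Finset.sum_congr rfl
        intro j hj
        have hj' := Finset.ne_of_mem_erase hj
        simp [handle, hj']
      rw [this]
      exact mul_ne_zero hcs (f0_ne p k hk1 _ _ hcoord)
    · have : h₀ (handle i v) = c i * f0 p k (v (i, true)) (v (i, false)) := by
        simp only [h₀]
        rw [Finset.sum_eq_single i]
        · simp [handle, Ne.symm hi]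
        · intro j _ hji
          simp [handle, hji, Ne.symm hi, f0_zero]
        · intro hh
          exact absurd (Finset.mem_erase.2 ⟨hi, Finset.mem_univ _⟩) hh
      rw [this]
      exact mul_ne_zero (hc i) (f0_ne p k hk1 _ _ hcoord.symm)
  have : Nonempty (Fin g × Bool) := ⟨(i₀, true)⟩
  let F : (Fin g × Bool → ZMod p) → ZMod p := fun v => v (Classical.epsilon fun t => v t ≠ 0)
  have hFne : ∀ v, v ≠ 0 → F v ≠ 0 := by
    intro v hv
    have : ∃ t, v t ≠ 0 := by
      by_contra hcon
      push Not at hcon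
      exact hv (funext hcon)
    exact Classical.epsilon_spec (p := fun t => v t ≠ 0) this
  have hFhom : ∀ (a : (ZMod p)ˣ) v, F ((a : ZMod p) • v) = a * F v := by
    intro a v
    have : (fun t => ((a : ZMod p) • v) t ≠ 0) = fun t => v t ≠ 0 := by
      ext t
      simp
    simp only [F, this]
    simp
  let h₁ : (Fin g × Bool → ZMod p) → ZMod p := fun v => if ∃ i, handle i v = v then h₀ v else F v
  have hhs : ∀ (i : Fin g) (a : ZMod p) (v : Fin g × Bool → ZMod p), handle i (a • v) = a • handle i v := by
    intro i a v
    ext t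
    simp [handle]
  have hu : h₁ - h₀ ∈ achSub g p (p ^ k) := by
    apply ach_vanish g p k hk
    · intro a v
      have hiff : (∃ i, handle i ((a : ZMod p) • v) = (a : ZMod p) • v) ↔ ∃ i, handle i v = v := by
        apply exists_congr
        intro i
        rw [hhs]
        exact smul_right_inj a.ne_zero
      simp only [Pi.sub_apply, h₁, hiff, hom₀, hFhom]
      split_ifs <;> ring
    · intro i v
      have : ∃ l, handle l (handle i v) = handle i v := ⟨i, by ext t; by_cases ht : t.1 = i <;> simp [handle, ht]⟩
      simp [h₁, this]
    · have : ∃ l : Fin g, handle l (0 : Fin g × Bool → ZMod p) = 0 := ⟨i₀, by ext t; simp [handle]⟩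
      simp [h₁, this]
  refine ⟨p ^ k, h₁, ?_, ?_⟩
  · have : h₁ ∈ achSub g p (p ^ k) := by
      have := add_mem hu hh₀
      rwa [sub_add_cancel] at this
    exact this
  · intro v hv
    simp only [h₁]
    split_ifs with hcase
    · obtain ⟨i, hi⟩ := hcase
      rw [← hi]
      apply hne₀
      rwa [hi]
    · exact hFne v hv

/-- Corollary 3.2 (surface case): the homology generated by elevations of elements of
minimal generating sets (of cardinality 2g) of π₁Σ_g is a proper subspace of the homology
of a suitable normal cover of r-power index. -/
theorem primitive_homology_surface (g : ℕ) (hg : 2 ≤ g)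
    (r : ℕ) (hr : r.Prime) (hodd : Odd r) :
    ∃ R : Subgroup (SurfaceGroup g), R.Normal ∧ R.FiniteIndex ∧
      (∃ k : ℕ, R.index = r ^ k) ∧
      OHomology R {x | ∃ S : Finset (SurfaceGroup g), S.card = 2 * g ∧
        Subgroup.closure (S : Set (SurfaceGroup g)) = ⊤ ∧ x ∈ S} ≠ ⊤ := by
  have : Fact r.Prime := ⟨hr⟩
  obtain ⟨d, h, hach, hne⟩ := exists_ach g hg r hodd
  exact main_of_ach g hg r d h hach hne
end

section
/- Let F be a free group of finite rank m ≥ 2, let r be an odd prime, and let 𝒪 ⊆ F ∖ {1} be a subset that is contained in the union of finitely many orbits of the natural action of Aut(F) on F. Then there exists a finite-index normal subgroup R of F whose index [F : R] is a power of r and such that H₁^𝒪(R;ℚ) is a proper ℚ-subspace of H₁(R;ℚ) = Abelianization(R) ⊗_ℤ ℚ. -/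
open scoped TensorProduct


namespace OrbHom

/-- Upper unitriangular with superdiagonal `s`. -/
def UTri {A : Type} [CommRing A] {n : ℕ} (M : Matrix (Fin (n+1)) (Fin (n+1)) A) (s : ℕ → A) : Prop :=
  (∀ i l : Fin (n+1), (l : ℕ) < i → M i l = 0) ∧ (∀ i, M i i = 1) ∧
    (∀ i l : Fin (n+1), (l : ℕ) = i + 1 → M i l = s i)

section
variable {A : Type} [CommRing A] {n : ℕ}

lemma UTri.one : UTri (1 : Matrix (Fin (n+1)) (Fin (n+1)) A) 0 := by
  refine ⟨fun i l h => ?_, fun i => by simp, fun i l h => ?_⟩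
  · rw [Matrix.one_apply_ne]; rintro rfl; omega
  · rw [Matrix.one_apply_ne]
    · rfl
    · rintro rfl; omega

lemma UTri.mul {M M' : Matrix (Fin (n+1)) (Fin (n+1)) A} {s s' : ℕ → A}
    (h : UTri M s) (h' : UTri M' s') : UTri (M * M') (s + s') := by
  obtain ⟨a, b, c⟩ := h
  obtain ⟨a', b', c'⟩ := h'
  refine ⟨fun i l hl => ?_, fun i => ?_, fun i l hl => ?_⟩
  · rw [Matrix.mul_apply]
    apply Finset.sum_eq_zero
    intro j _
    by_cases hj : (j : ℕ) < i
    · rw [a i j hj, zero_mul]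
    · rw [a' j l (by omega), mul_zero]
  · rw [Matrix.mul_apply, Finset.sum_eq_single i]
    · rw [b, b', one_mul]
    · intro j _ hj
      have : (j : ℕ) ≠ i := fun h => hj (Fin.ext h)
      by_cases hj : (j : ℕ) < i
      · rw [a i j hj, zero_mul]
      · rw [a' j i (by omega), mul_zero]
    · simp
  · have hil : i ≠ l := by rintro rfl; omega
    rw [Matrix.mul_apply, Finset.sum_eq_add i l hil]
    · rw [b, b', c i l hl, c' i l hl, one_mul, mul_one, Pi.add_apply, add_comm]
    · intro j _ hj
      have h1 : (j : ℕ) ≠ i := fun h => hj.1 (Fin.ext h)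
      have h2 : (j : ℕ) ≠ l := fun h => hj.2 (Fin.ext h)
      by_cases hj : (j : ℕ) < i
      · rw [a i j hj, zero_mul]
      · rw [a' j l (by omega), mul_zero]
    · simp
    · simp

lemma UTri.pow {M : Matrix (Fin (n+1)) (Fin (n+1)) A} {s : ℕ → A}
    (h : UTri M s) (k : ℕ) : UTri (M ^ k) (k • s) := by
  induction k with
  | zero => simpa using UTri.one
  | succ k ih => rw [pow_succ, succ_nsmul]; exact ih.mul h

lemma UTri.sub_pow {M : Matrix (Fin (n+1)) (Fin (n+1)) A} {s : ℕ → A}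
    (h : UTri M s) (k : ℕ) (i l : Fin (n+1)) :
    ((l : ℕ) < i + k → ((M - 1) ^ k) i l = 0) ∧
    ((l : ℕ) = i + k → ((M - 1) ^ k) i l = ∏ t ∈ Finset.range k, s (i + t)) := by
  obtain ⟨a, b, c⟩ := h
  have hX : ∀ i l : Fin (n+1), (l : ℕ) ≤ i → (M - 1) i l = 0 := by
    intro i l hl
    rcases eq_or_ne i l with rfl | hne
    · simp [b]
    · have : (i : ℕ) ≠ l := fun h => hne (Fin.ext h)
      rw [Matrix.sub_apply, Matrix.one_apply_ne hne, a i l (by omega), sub_zero]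
  have hX1 : ∀ i l : Fin (n+1), (l : ℕ) = i + 1 → (M - 1) i l = s i := by
    intro i l hl
    rw [Matrix.sub_apply, Matrix.one_apply_ne (by rintro rfl; omega), c i l hl, sub_zero]
  induction k generalizing l with
  | zero =>
    refine ⟨fun h => ?_, fun h => ?_⟩
    · rw [pow_zero, Matrix.one_apply_ne]; rintro rfl; omega
    · have : i = l := Fin.ext (by omega)
      subst this; simp
  | succ k ih =>
    refine ⟨fun h => ?_, fun h => ?_⟩
    · rw [pow_succ, Matrix.mul_apply]
      apply Finset.sum_eq_zero
      intro j _
      by_cases hj : (j : ℕ) < i + k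
      · rw [(ih j).1 hj, zero_mul]
      · rw [hX j l (by omega), mul_zero]
    · rw [pow_succ, Matrix.mul_apply, Finset.sum_eq_single (⟨i + k, by omega⟩ : Fin (n+1))]
      · rw [(ih _).2 rfl, hX1 _ l (by simp; omega), Finset.prod_range_succ]
      · intro j _ hj
        have h1 : (j : ℕ) ≠ i + k := fun h => hj (Fin.ext h)
        by_cases hj : (j : ℕ) < i + k
        · rw [(ih j).1 hj, zero_mul]
        · rw [hX j l (by omega), mul_zero]
      · simp

lemma UTri.nilp {M : Matrix (Fin (n+1)) (Fin (n+1)) A} {s : ℕ → A}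
    (h : UTri M s) (k : ℕ) (hk : n + 1 ≤ k) : (M - 1) ^ k = 0 := by
  ext i l
  exact (h.sub_pow k i l).1 (by omega)

lemma UTri.corner {M : Matrix (Fin (n+1)) (Fin (n+1)) A} {s : ℕ → A}
    (h : UTri M s) : (M - 1) ^ n =
      Matrix.single 0 (Fin.last n) (∏ t ∈ Finset.range n, s t) := by
  ext i l
  by_cases hh : i = 0 ∧ l = Fin.last n
  · obtain ⟨rfl, rfl⟩ := hh
    rw [(h.sub_pow n _ _).2 (by simp)]; simp
  · rw [(h.sub_pow n i l).1, Matrix.single_apply_of_ne]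
    · rintro ⟨h1, h2⟩; exact hh ⟨h1.symm, h2.symm⟩
    · by_contra hlt
      exact hh ⟨Fin.ext (by rw [Fin.val_zero]; omega), Fin.ext (by rw [Fin.val_last]; omega)⟩

/-- A matrix ring in which `p ^ N = 0`: unitriangular matrices have `p`-power order. -/
lemma pow_eq_one_of_nilp {B : Type} [Ring B] (p : ℕ) [hp : Fact p.Prime] (N k : ℕ)
    (hN : ((p : ℕ) : B) ^ (N + 1) = 0) (M : B) (hk : (M - 1) ^ (p ^ k) = 0) :
    M ^ (p ^ (k + N)) = 1 := by
  have h0 : ((p : ℕ) : Polynomial ℤ) ∣ (1 + Polynomial.X) ^ (p ^ k) - (1 + Polynomial.X ^ (p ^ k)) := by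
    obtain ⟨c, hc⟩ := exists_add_pow_prime_pow_eq hp.out (1 : Polynomial ℤ) Polynomial.X k
    rw [hc, one_pow]
    exact ⟨_, by rw [add_sub_cancel_left, mul_assoc, mul_assoc]⟩
  have h1 := dvd_sub_pow_of_dvd_sub h0 N
  obtain ⟨c, hc⟩ := h1
  have h2 := congrArg (Polynomial.aeval (M - 1)) hc
  simp [hk, hN, ← pow_mul, ← pow_add] at h2
  exact sub_eq_zero.1 h2

end
end OrbHom
namespace OrbHom

/-- A homomorphism to a rational vector space that kills all elevations but is nonzero. -/
lemma ohom_ne_top_of_hom {π : Type} [Group π] (R : Subgroup π) (O : Set π)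
    {W : Type} [AddCommGroup W] [Module ℚ W] (f : R →* Multiplicative W)
    (hf : ∀ x ∈ O, ∀ m : ℤ, ∀ h : x ^ m ∈ R, f ⟨x ^ m, h⟩ = 1)
    (hne : ∃ y, f y ≠ 1) : OHomology R O ≠ ⊤ := by
  intro htop
  let g : Additive (Abelianization R) →+ W :=
    MonoidHom.toAdditiveLeft (Abelianization.lift f)
  let L : ℚ ⊗[ℤ] Additive (Abelianization R) →ₗ[ℚ] W := g.toIntLinearMap.liftBaseChange ℚ
  have hL : ∀ y : R, L ((1 : ℚ) ⊗ₜ[ℤ] Additive.ofMul (Abelianization.of y)) =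
      Multiplicative.toAdd (f y) := by
    intro y
    simp [L, g]
  have hle : OHomology R O ≤ LinearMap.ker L := by
    apply Submodule.span_le.2
    rintro v ⟨x, hx, m, h, rfl⟩
    simp only [SetLike.mem_coe, LinearMap.mem_ker]
    rw [hL, hf x hx m h]; rfl
  obtain ⟨y, hy⟩ := hne
  apply hy
  have : (1 : ℚ) ⊗ₜ[ℤ] Additive.ofMul (Abelianization.of y) ∈ LinearMap.ker L :=
    hle (htop ▸ Submodule.mem_top)
  rw [LinearMap.mem_ker, hL] at this
  exact this

/-- Farb–Hensel style criterion, via crossed homomorphisms. -/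
lemma ohom_ne_top_of_rep (m : ℕ) (hm : 2 ≤ m) (R : Subgroup (FreeGroup (Fin m)))
    [R.Normal] [R.FiniteIndex] (O : Set (FreeGroup (Fin m)))
    {W : Type} [AddCommGroup W] [Module ℂ W] [FiniteDimensional ℂ W] [Nontrivial W]
    (ρ : FreeGroup (Fin m) →* (W ≃ₗ[ℂ] W)) (hR : ∀ g ∈ R, ρ g = 1)
    (hO : ∀ x ∈ O, ∃ M : ℕ, ∀ w, ρ (x ^ M) w = w → w = 0) : OHomology R O ≠ ⊤ := by
  classical
  let _ : Module ℚ W := Module.compHom W (algebraMap ℚ ℂ)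
  -- choose values of the crossed homomorphism
  let D : W →ₗ[ℂ] (Fin m → W) :=
    LinearMap.pi fun i => LinearMap.id - (ρ (FreeGroup.of i) : W →ₗ[ℂ] W)
  have hD : ¬ Function.Surjective D := by
    intro hs
    have h1 : Module.finrank ℂ (Fin m → W) ≤ Module.finrank ℂ W := by
      have := LinearMap.finrank_range_le D
      rwa [LinearMap.range_eq_top.2 hs, finrank_top] at this
    rw [Module.finrank_pi_fintype] at h1
    have h2 : 0 < Module.finrank ℂ W := Module.finrank_pos
    simp at h1
    nlinarith
  obtain ⟨b, hb⟩ := not_forall.1 hD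
  let A : FreeGroup (Fin m) →* (W ≃ᵃ[ℂ] W) := FreeGroup.lift fun i =>
    (ρ (FreeGroup.of i)).toAffineEquiv.trans (AffineEquiv.constVAdd ℂ W (b i))
  have hA : ∀ g, (A g).linear = ρ g := by
    have : (AffineEquiv.linearHom).comp A = ρ := by
      ext i w
      simp [A]
      rfl
    intro g
    exact DFunLike.congr_fun this g
  have hAg : ∀ g w, A g w = ρ g w + A g 0 := by
    intro g w
    have := (A g).map_vadd 0 w
    simpa [hA] using this
  let c : FreeGroup (Fin m) → W := fun g => A g 0
  have hc : ∀ g h, c (g * h) = ρ g (c h) + c g := by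
    intro g h
    simp only [c, map_mul, AffineEquiv.mul_def, AffineEquiv.trans_apply]
    exact hAg g _
  let f : R →* Multiplicative W := MonoidHom.mk' (fun y => Multiplicative.ofAdd (c y)) (by
    intro x y
    simp only [Subgroup.coe_mul, hc, hR _ x.2]
    rw [← ofAdd_add, add_comm]; rfl)
  apply ohom_ne_top_of_hom R O f
  · intro x hx k h
    have h1 := hc x (x ^ k)
    have h2 := hc (x ^ k) x
    rw [(Commute.self_zpow x k).eq, h2, hR _ h] at h1
    have h3 : ρ x (c (x ^ k)) = c (x ^ k) := by
      have : (1 : W ≃ₗ[ℂ] W) (c x) = c x := rfl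
      rw [this, add_comm] at h1
      exact (add_right_cancel h1).symm
    obtain ⟨M, hM⟩ := hO x hx
    change Multiplicative.ofAdd (c (x ^ k)) = 1
    rw [hM (c (x ^ k))]
    · rfl
    · clear hM
      induction M with
      | zero => simp
      | succ M ih => rw [pow_succ, map_mul, LinearEquiv.mul_apply, h3, ih]
  · by_contra hcon
    push Not at hcon
    have hcR : ∀ y ∈ R, c y = 0 := fun y hy => hcon ⟨y, hy⟩
    have hinv : ∀ g, ∀ y ∈ R, c (g * y) = c g := by
      intro g y hy
      rw [hc, hcR y hy, map_zero, zero_add]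
    have : Fintype (FreeGroup (Fin m) ⧸ R) := Fintype.ofFinite _
    let cq : FreeGroup (Fin m) ⧸ R → W := Quotient.lift c (by
      intro a b hab
      have hab' : a⁻¹ * b ∈ R := QuotientGroup.leftRel_apply.1 hab
      rw [← hinv a _ hab', mul_inv_cancel_left])
    have hcq : ∀ g : FreeGroup (Fin m), cq (g : FreeGroup (Fin m) ⧸ R) = c g := fun g => rfl
    let S : W := ∑ q, cq q
    let n : ℂ := Fintype.card (FreeGroup (Fin m) ⧸ R)
    have hn : n ≠ 0 := by
      simp [n]
    have hS : ∀ g, S = ρ g S + n • c g := by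
      intro g
      have h1 : S = ∑ q, cq ((g : FreeGroup (Fin m) ⧸ R) * q) :=
        (Fintype.sum_equiv (Equiv.mulLeft (g : FreeGroup (Fin m) ⧸ R)) _ _ (fun q => rfl)).symm
      have h2 : ∀ q, cq ((g : FreeGroup (Fin m) ⧸ R) * q) = ρ g (cq q) + c g := by
        intro q
        induction q using QuotientGroup.induction_on with
        | H h => rw [← QuotientGroup.mk_mul, hcq, hcq, hc]
      conv_lhs => rw [h1]
      simp only [h2]
      rw [Finset.sum_add_distrib, ← map_sum, Finset.sum_const, Finset.card_univ]
      rw [← Nat.cast_smul_eq_nsmul ℂ]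
    apply hb
    refine ⟨n⁻¹ • S, ?_⟩
    ext i
    have h := hS (FreeGroup.of i)
    have hci : c (FreeGroup.of i) = b i := by simp [c, A]
    rw [hci] at h
    have h' : S - ρ (FreeGroup.of i) S = n • b i := by
      rw [sub_eq_iff_eq_add, add_comm]; exact h
    simp only [D, LinearMap.pi_apply, LinearMap.sub_apply, LinearMap.id_apply,
      LinearEquiv.coe_coe, map_smul]
    rw [h', smul_smul, inv_mul_cancel₀ hn, one_smul]

end OrbHom
namespace OrbHom

/-- The group of unitriangular matrices. -/
def UTGroup (A : Type) [CommRing A] (n : ℕ) : Subgroup (Matrix (Fin (n+1)) (Fin (n+1)) A)ˣ where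
  carrier := {u | (∃ s, UTri (u : Matrix (Fin (n+1)) (Fin (n+1)) A) s) ∧
    ∃ s, UTri ((u⁻¹ : (Matrix (Fin (n+1)) (Fin (n+1)) A)ˣ) : Matrix (Fin (n+1)) (Fin (n+1)) A) s}
  one_mem' := ⟨⟨0, UTri.one⟩, ⟨0, by simpa using UTri.one⟩⟩
  mul_mem' := by
    rintro a b ⟨⟨s, hs⟩, ⟨t, ht⟩⟩ ⟨⟨s', hs'⟩, ⟨t', ht'⟩⟩
    refine ⟨⟨s + s', hs.mul hs'⟩, ⟨t' + t, ?_⟩⟩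
    rw [mul_inv_rev]
    exact ht'.mul ht
  inv_mem' := by
    rintro a ⟨h, h'⟩
    exact ⟨h', by rwa [inv_inv]⟩

/-- Syllable product. -/
def syl {α : Type} (L : List (α × ℤ)) : FreeGroup α :=
  (L.map fun z => FreeGroup.of z.1 ^ z.2).prod

lemma exists_syl {α : Type} (x : FreeGroup α) : ∃ L : List (α × ℤ), syl L = x := by
  induction x using FreeGroup.induction_on with
  | C1 => exact ⟨[], rfl⟩
  | of a => exact ⟨[(a, 1)], by simp [syl]⟩
  | inv_of a _ => exact ⟨[(a, -1)], by simp [syl]⟩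
  | mul x y hx hy =>
    obtain ⟨L, rfl⟩ := hx
    obtain ⟨L', rfl⟩ := hy
    exact ⟨L ++ L', by simp [syl]⟩

/-- Reduced syllable lists. -/
def Red {α : Type} (L : List (α × ℤ)) : Prop :=
  (∀ z ∈ L, z.2 ≠ 0) ∧ L.IsChain (fun a b => a.1 ≠ b.1)

lemma exists_red {α : Type} (L : List (α × ℤ)) : ∃ L', Red L' ∧ syl L' = syl L := by
  classical
  induction L with
  | nil => exact ⟨[], ⟨by simp, by simp⟩, rfl⟩
  | cons z L ih =>
    obtain ⟨L', ⟨h0, h1⟩, hL⟩ := ih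
    have e : syl (z :: L) = FreeGroup.of z.1 ^ z.2 * syl L' := by rw [hL]; simp [syl]
    rw [e]
    by_cases hz : z.2 = 0
    · exact ⟨L', ⟨h0, h1⟩, by simp [hz]⟩
    cases L' with
    | nil => exact ⟨[z], ⟨by simpa using hz, by simp⟩, by simp [syl]⟩
    | cons w L'' =>
      have h0' : ∀ z ∈ L'', z.2 ≠ 0 := fun z hz => h0 z (List.mem_cons_of_mem _ hz)
      by_cases hzw : z.1 = w.1
      · have e2 : FreeGroup.of z.1 ^ z.2 * syl (w :: L'') =
            FreeGroup.of w.1 ^ (z.2 + w.2) * syl L'' := by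
          simp [syl, hzw, zpow_add, mul_assoc]
        rw [e2]
        by_cases hs : z.2 + w.2 = 0
        · exact ⟨L'', ⟨h0', h1.tail⟩, by simp [hs]⟩
        · refine ⟨(w.1, z.2 + w.2) :: L'', ⟨?_, ?_⟩, by simp [syl]⟩
          · intro y hy
            rcases List.mem_cons.1 hy with rfl | hy
            · exact hs
            · exact h0' y hy
          · rw [List.isChain_cons] at h1 ⊢
            exact h1
      · refine ⟨z :: w :: L'', ⟨?_, ?_⟩, by simp [syl]⟩
        · intro y hy
          rcases List.mem_cons.1 hy with rfl | hy
          · exact hz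
          · exact h0 y hy
        · exact List.isChain_cons_cons.2 ⟨hzw, h1⟩

open Classical in
/-- The square-zero matrix attached to a letter. -/
noncomputable def letterMat {α : Type} (A : Type) [CommRing A] (L : List (α × ℤ)) (i : α) :
    Matrix (Fin (L.length+1)) (Fin (L.length+1)) A :=
  fun a b => if ∃ h : (a : ℕ) < L.length, (L[(a : ℕ)]).1 = i ∧ (b : ℕ) = a + 1 then 1 else 0

lemma letterMat_sq {α : Type} (A : Type) [CommRing A] (L : List (α × ℤ)) (hL : Red L) (i : α) :
    letterMat A L i * letterMat A L i = 0 := by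
  ext a b
  rw [Matrix.mul_apply]
  apply Finset.sum_eq_zero
  intro c _
  unfold letterMat
  by_cases h : ∃ h : (a : ℕ) < L.length, (L[(a : ℕ)]).1 = i ∧ (c : ℕ) = a + 1
  · by_cases h' : ∃ h : (c : ℕ) < L.length, (L[(c : ℕ)]).1 = i ∧ (b : ℕ) = c + 1
    · exfalso
      obtain ⟨h1, h2, h3⟩ := h
      obtain ⟨h1', h2', h3'⟩ := h'
      have := List.isChain_iff_getElem.1 hL.2 a (by omega)
      simp only [h3] at h2'
      exact this (h2.trans h2'.symm)
    · rw [if_neg h', mul_zero]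
  · rw [if_neg h, zero_mul]

lemma letterMat_sq' {α : Type} (A : Type) [CommRing A] (L : List (α × ℤ)) (hL : Red L) (i : α)
    (k l : ℤ) : (k • letterMat A L i) * (l • letterMat A L i) = 0 := by
  rw [smul_mul_smul_comm, letterMat_sq A L hL, smul_zero]

/-- The unit `1 + k X_i`. -/
noncomputable def letterUnit {α : Type} (A : Type) [CommRing A] (L : List (α × ℤ)) (hL : Red L)
    (i : α) (k : ℤ) : (Matrix (Fin (L.length+1)) (Fin (L.length+1)) A)ˣ where
  val := 1 + k • letterMat A L i
  inv := 1 - k • letterMat A L i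
  val_inv := by
    rw [mul_sub, add_mul, add_mul, letterMat_sq' A L hL]
    simp
  inv_val := by
    rw [mul_add, sub_mul, sub_mul, letterMat_sq' A L hL]
    simp

lemma letterUnit_zpow {α : Type} (A : Type) [CommRing A] (L : List (α × ℤ)) (hL : Red L)
    (i : α) (k : ℤ) : letterUnit A L hL i 1 ^ k = letterUnit A L hL i k := by
  let f : Multiplicative ℤ →* (Matrix (Fin (L.length+1)) (Fin (L.length+1)) A)ˣ :=
    MonoidHom.mk' (fun k => letterUnit A L hL i (Multiplicative.toAdd k)) (by
      intro a b
      ext1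
      simp only [letterUnit, Units.val_mul, toAdd_mul]
      rw [mul_add, add_mul, add_mul, letterMat_sq' A L hL, add_smul]
      simp [add_assoc])
  have h := map_zpow f (Multiplicative.ofAdd 1) k
  rw [← ofAdd_zsmul] at h
  simpa [f] using h.symm

lemma letter_utri {α : Type} (A : Type) [CommRing A] (L : List (α × ℤ)) (i : α) (k : ℤ) :
    ∃ s, UTri (1 + k • letterMat A L i) s := by
  classical
  refine ⟨fun a => if ∃ h : a < L.length, (L[a]).1 = i then (k : A) else 0, ?_, ?_, ?_⟩
  · intro a b h
    rw [Matrix.add_apply, Matrix.one_apply_ne (by rintro rfl; omega), Matrix.smul_apply]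
    unfold letterMat
    rw [if_neg (by rintro ⟨_, _, _⟩; omega)]
    simp
  · intro a
    rw [Matrix.add_apply, Matrix.one_apply_eq, Matrix.smul_apply]
    unfold letterMat
    rw [if_neg (by rintro ⟨_, _, _⟩; omega)]
    simp
  · intro a b h
    rw [Matrix.add_apply, Matrix.one_apply_ne (by rintro rfl; omega), Matrix.smul_apply]
    unfold letterMat
    simp [h]

/-- Magnus-type representation attached to a reduced list. -/
noncomputable def magnus {α : Type} (A : Type) [CommRing A] (L : List (α × ℤ)) (hL : Red L) :
    FreeGroup α →* UTGroup A L.length :=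
  FreeGroup.lift fun i => ⟨letterUnit A L hL i 1, letter_utri A L i 1, by
    have := letter_utri A L i (-1)
    rw [neg_smul, ← sub_eq_add_neg] at this
    exact this⟩

lemma magnus_val {α : Type} (A : Type) [CommRing A] (L : List (α × ℤ)) (hL : Red L)
    (l : List (α × ℤ)) :
    ((magnus A L hL (syl l) : (Matrix (Fin (L.length+1)) (Fin (L.length+1)) A)ˣ) :
      Matrix (Fin (L.length+1)) (Fin (L.length+1)) A) =
      (l.map fun z => 1 + z.2 • letterMat A L z.1).prod := by
  induction l with
  | nil => simp [syl]
  | cons z l ih =>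
    have : syl (z :: l) = FreeGroup.of z.1 ^ z.2 * syl l := by simp [syl]
    rw [this, map_mul, map_zpow]
    have h2 : ((magnus A L hL (FreeGroup.of z.1) ^ z.2 : UTGroup A L.length) :
      (Matrix (Fin (L.length+1)) (Fin (L.length+1)) A)ˣ) = letterUnit A L hL z.1 z.2 := by
      rw [← letterUnit_zpow]
      simp [magnus]
    rw [Subgroup.coe_mul, h2, Units.val_mul, ih, List.map_cons, List.prod_cons]
    rfl

lemma row_zero {α : Type} (A : Type) [CommRing A] (L : List (α × ℤ)) (t : ℕ) (ht : t ≤ L.length)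
    (b : Fin (L.length + 1)) :
    (t < (b : ℕ) → (((L.take t).map fun z : α × ℤ => 1 + z.2 • letterMat A L z.1).prod) 0 b = 0) ∧
    ((b : ℕ) = t → (((L.take t).map fun z : α × ℤ => 1 + z.2 • letterMat A L z.1).prod) 0 b =
      ((((L.take t).map Prod.snd).prod : ℤ) : A)) := by
  induction t generalizing b with
  | zero =>
    refine ⟨fun h => ?_, fun h => ?_⟩
    · simp only [List.take_zero, List.map_nil, List.prod_nil]
      rw [Matrix.one_apply_ne]
      rintro rfl
      simp at h
    · have : b = 0 := Fin.ext (by simpa using h)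
      simp [this]
  | succ t ih =>
    have htl : t < L.length := ht
    have ih' := ih htl.le
    have hlast : ∀ (β : Type) [Monoid β] (f : α × ℤ → β),
        ((L.take (t+1)).map f).prod = ((L.take t).map f).prod * f L[t] := by
      intro β _ f
      rw [List.take_succ_eq_append_getElem htl, List.map_append, List.prod_append]
      simp
    rw [hlast, hlast, mul_add, mul_one]
    set P := ((L.take t).map fun z : α × ℤ => 1 + z.2 • letterMat A L z.1).prod with hP
    refine ⟨fun h => ?_, fun h => ?_⟩
    · rw [Matrix.add_apply, (ih' b).1 (by omega), Matrix.mul_apply, zero_add]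
      apply Finset.sum_eq_zero
      intro c _
      by_cases hc : t < (c : ℕ)
      · rw [(ih' c).1 hc, zero_mul]
      · rw [Matrix.smul_apply]
        unfold letterMat
        rw [if_neg (by rintro ⟨_, _, _⟩; omega)]
        simp
    · rw [Matrix.add_apply, (ih' b).1 (by omega), Matrix.mul_apply, zero_add,
        Finset.sum_eq_single (⟨t, by omega⟩ : Fin (L.length+1))]
      · rw [(ih' _).2 rfl, Matrix.smul_apply]
        unfold letterMat
        rw [if_pos ⟨htl, rfl, h⟩]
        simp
      · intro c _ hct
        have hct' : (c : ℕ) ≠ t := fun h => hct (Fin.ext h)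
        by_cases hc : t < (c : ℕ)
        · rw [(ih' c).1 hc, zero_mul]
        · rw [Matrix.smul_apply]
          unfold letterMat
          rw [if_neg (by rintro ⟨_, _, _⟩; omega)]
          simp
      · simp

lemma UTGroup_exp (p : ℕ) [hp : Fact p.Prime] (N n : ℕ) :
    ∀ u : UTGroup (ZMod (p ^ (N + 1))) n, u ^ (p ^ ((n + 1) + N)) = 1 := by
  rintro ⟨u, ⟨s, hs⟩, hu⟩
  ext1
  ext1
  have hk : ((u : Matrix (Fin (n+1)) (Fin (n+1)) (ZMod (p ^ (N + 1)))) - 1) ^ (p ^ (n + 1)) = 0 :=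
    hs.nilp _ (Nat.lt_pow_self hp.out.one_lt).le
  have hN : ((p : ℕ) : Matrix (Fin (n+1)) (Fin (n+1)) (ZMod (p ^ (N + 1)))) ^ (N + 1) = 0 := by
    have h0 : ((p ^ (N + 1) : ℕ) : ZMod (p ^ (N + 1))) = 0 := ZMod.natCast_self _
    rw [← Nat.cast_pow]
    ext i j
    rw [Matrix.natCast_apply]
    split_ifs
    · exact h0
    · simp
  have := pow_eq_one_of_nilp p N (n + 1) hN _ hk
  simpa using this

/-- Free groups are residually finite `p`-groups. -/
lemma residually_p {α : Type} (p : ℕ) [hp : Fact p.Prime] (x : FreeGroup α) (hx : x ≠ 1) :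
    ∃ (n N : ℕ) (θ : FreeGroup α →* UTGroup (ZMod (p ^ (N + 1))) n), θ x ≠ 1 := by
  obtain ⟨L0, h0⟩ := exists_syl x
  obtain ⟨L, hL, hLx⟩ := exists_red L0
  rw [h0] at hLx
  have hprod : (L.map Prod.snd).prod ≠ 0 := by
    rw [Ne, List.prod_eq_zero_iff]
    intro h
    obtain ⟨z, hz, hz0⟩ := List.mem_map.1 h
    exact hL.1 z hz hz0
  set k : ℤ := (L.map Prod.snd).prod with hk
  refine ⟨L.length, k.natAbs, magnus _ L hL, ?_⟩
  intro h
  have h1 := magnus_val (ZMod (p ^ (k.natAbs + 1))) L hL L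
  rw [hLx, h] at h1
  have h2 := (row_zero (ZMod (p ^ (k.natAbs + 1))) L L.length le_rfl (Fin.last _)).2 (by simp)
  rw [List.take_length, ← h1, ← hk] at h2
  have hlen : L.length ≠ 0 := by
    intro hl
    have : L = [] := List.length_eq_zero_iff.1 hl
    apply hx
    rw [← hLx, this]; rfl
  simp only [OneMemClass.coe_one, Units.val_one] at h2
  rw [Matrix.one_apply_ne (by intro h; apply hlen; simpa using (congrArg Fin.val h).symm)] at h2
  have h3 := ((ZMod.intCast_zmod_eq_zero_iff_dvd k _).1 h2.symm)
  have h4 : p ^ (k.natAbs + 1) ∣ k.natAbs := by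
    have := Int.natAbs_dvd_natAbs.2 h3
    simpa using this
  have h5 := Nat.le_of_dvd (Int.natAbs_pos.2 hprod) h4
  have h6 : k.natAbs + 1 < p ^ (k.natAbs + 1) := Nat.lt_pow_self hp.out.one_lt
  omega

/-- A normal subgroup of `p`-power index avoiding `O`. -/
lemma exists_avoiding (m p : ℕ) [hp : Fact p.Prime]
    (O : Set (FreeGroup (Fin m))) (h1 : (1 : FreeGroup (Fin m)) ∉ O)
    (T : Finset (FreeGroup (Fin m)))
    (hO : ∀ x ∈ O, ∃ t ∈ T, ∃ φ : MulAut (FreeGroup (Fin m)), φ t = x) :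
    ∃ K : Subgroup (FreeGroup (Fin m)), K.Normal ∧ K.FiniteIndex ∧
      (∀ g, ∃ k, g ^ (p ^ k) ∈ K) ∧ ∀ x ∈ O, x ∉ K := by
  classical
  have hres : ∀ t : FreeGroup (Fin m), ∃ (n N : ℕ)
      (θ : FreeGroup (Fin m) →* UTGroup (ZMod (p ^ (N + 1))) n), t ≠ 1 → θ t ≠ 1 := by
    intro t
    by_cases ht : t = 1
    · exact ⟨0, 0, 1, fun h => absurd ht h⟩
    · obtain ⟨n, N, θ, h⟩ := residually_p p t ht
      exact ⟨n, N, θ, fun _ => h⟩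
  choose n N θ hθ using hres
  let G : T → Type := fun t => UTGroup (ZMod (p ^ (N t + 1))) (n t)
  have : ∀ t, Finite (G t) := fun t => by
    have : NeZero (p ^ (N t + 1)) := ⟨pow_ne_zero _ hp.out.ne_zero⟩
    have : Finite (Matrix (Fin (n t +1)) (Fin (n t +1)) (ZMod (p ^ (N t + 1))))ˣ := inferInstance
    change Finite (UTGroup (ZMod (p ^ (N t + 1))) (n t))
    infer_instance
  have : ∀ t, Finite (FreeGroup (Fin m) →* G t) := fun t =>
    Finite.of_equiv (Fin m → G t) FreeGroup.lift
  let Φ : FreeGroup (Fin m) →* ((t : T) → (FreeGroup (Fin m) →* G t) → G t) :=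
    MonoidHom.pi fun t => MonoidHom.pi fun f => f
  have hΦ : ∀ g, g ∈ Φ.ker ↔ ∀ t, ∀ f : FreeGroup (Fin m) →* G t, f g = 1 := by
    intro g
    rw [MonoidHom.mem_ker, funext_iff]
    refine forall_congr' fun t => ?_
    rw [funext_iff]
    rfl
  have hG : ∀ t : T, ∀ u : G t, u ^ (p ^ ((n t + 1) + N t)) = 1 := fun t u => UTGroup_exp p _ _ u
  refine ⟨Φ.ker, inferInstance, inferInstance, ?_, ?_⟩
  · intro g
    refine ⟨∑ t : T, ((n t + 1) + N t), ?_⟩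
    rw [hΦ]
    intro t f
    obtain ⟨d, hd⟩ := pow_dvd_pow p (Finset.single_le_sum
      (f := fun t : T => (n t + 1) + N t) (fun _ _ => Nat.zero_le _) (Finset.mem_univ t))
    rw [map_pow, hd, pow_mul, hG, one_pow]
  · intro x hx hxK
    obtain ⟨t, ht, φ, rfl⟩ := hO x hx
    rw [hΦ] at hxK
    have h := hxK ⟨t, ht⟩ ((θ t).comp (φ⁻¹ : MulAut (FreeGroup (Fin m))).toMonoidHom)
    have ht1 : t ≠ 1 := by
      rintro rfl
      apply h1
      simpa using hx
    apply hθ t ht1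
    simpa using h

end OrbHom
namespace OrbHom

/-- If `y ∉ K` but `y ^ p ∈ K`, then `y ^ p` is nonzero in the mod `p` homology of `K`. -/
lemma exists_hom_pow_ne {F : Type} [Group F] [IsFreeGroup F] (K : Subgroup F) [K.Normal]
    (p : ℕ) [hp : Fact p.Prime] (y : F) (hy : y ∉ K) (hyp : y ^ p ∈ K) :
    ∃ η : K →* Multiplicative (ZMod p), η ⟨y ^ p, hyp⟩ ≠ 1 := by
  let q : F →* F ⧸ K := QuotientGroup.mk' K
  let Y : Subgroup F := (Subgroup.zpowers (q y)).comap q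
  have hYy : y ∈ Y := Subgroup.mem_zpowers (q y)
  have hKY : K ≤ Y := by
    intro k hk
    have : q k = 1 := (QuotientGroup.eq_one_iff k).2 hk
    change q k ∈ Subgroup.zpowers (q y)
    rw [this]; exact one_mem _
  have hord : orderOf (q y) = p := by
    apply orderOf_eq_prime
    · rw [← map_pow]; exact (QuotientGroup.eq_one_iff _).2 hyp
    · intro h; exact hy ((QuotientGroup.eq_one_iff _).1 h)
  let b := IsFreeGroup.basis Y
  have hex : ∀ h : Y, ∃ k : ℤ, q y ^ k = q h := fun h => Subgroup.mem_zpowers_iff.1 h.2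
  choose k hk using hex
  let θ : Y →* Multiplicative ℤ := b.lift fun i => Multiplicative.ofAdd (k (b i))
  have hθ : ∀ h : Y, q y ^ (Multiplicative.toAdd (θ h)) = q h := by
    have : (zpowersHom (F ⧸ K) (q y)).comp θ = q.comp Y.subtype := by
      apply b.ext_hom
      intro i
      have : θ (b i) = Multiplicative.ofAdd (k (b i)) := by simp [θ]
      rw [MonoidHom.comp_apply, this, zpowersHom_apply]
      exact hk (b i)
    intro h
    exact DFunLike.congr_fun this h
  have hdvd : ∀ h : K, (p : ℤ) ∣ Multiplicative.toAdd (θ ⟨h, hKY h.2⟩) := by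
    intro h
    rw [← hord, orderOf_dvd_iff_zpow_eq_one, hθ]
    exact (QuotientGroup.eq_one_iff _).2 h.2
  have hp0 : (p : ℤ) ≠ 0 := by exact_mod_cast hp.out.ne_zero
  let η : K →* Multiplicative (ZMod p) := MonoidHom.mk'
    (fun h => Multiplicative.ofAdd (((Multiplicative.toAdd (θ ⟨h, hKY h.2⟩) / p : ℤ) : ZMod p))) (by
      intro g h
      have : (⟨((g * h : K) : F), hKY (g * h).2⟩ : Y) = ⟨g, hKY g.2⟩ * ⟨h, hKY h.2⟩ := rfl
      rw [this, map_mul, toAdd_mul, Int.add_ediv_of_dvd_left (hdvd g), Int.cast_add, ofAdd_add])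
  refine ⟨η, ?_⟩
  intro h
  have h1 : ((Multiplicative.toAdd (θ ⟨y ^ p, hKY hyp⟩) / p : ℤ) : ZMod p) = 0 := h
  have h2 : (⟨y ^ p, hKY hyp⟩ : Y) = ⟨y, hYy⟩ ^ p := rfl
  rw [h2, map_pow, toAdd_pow, nsmul_eq_mul, Int.mul_ediv_cancel_left _ hp0,
    ZMod.intCast_zmod_eq_zero_iff_dvd] at h1
  rw [← hord, orderOf_dvd_iff_zpow_eq_one, hθ] at h1
  exact hy ((QuotientGroup.eq_one_iff _).1 h1)

end OrbHom
namespace OrbHom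

section five
variable {p : ℕ} [hp : Fact p.Prime] {L : Type} [Field L] [CharP L p]

/-- superdiagonal sequence. -/
def sdiag (p : ℕ) [_hp : Fact p.Prime] {L : Type} [Field L] [CharP L p] (a : L) : ℕ → L :=
  fun i => a ^ p ^ i

lemma sdiag_add (a b : L) : sdiag p (a + b) = sdiag p a + sdiag p b := by
  ext i; simp [sdiag, add_pow_char_pow]

lemma sdiag_neg (a : L) : sdiag p (-a) = - sdiag p a := by
  have h := sdiag_add (p := p) a (-a)
  have h0 : sdiag p (0 : L) = 0 := by
    ext i; simp [sdiag, hp.out.ne_zero]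
  rw [add_neg_cancel, h0] at h
  exact (neg_eq_of_add_eq_zero_right h.symm).symm

/-- The generator matrix. -/
def genMat (p : ℕ) [hp : Fact p.Prime] {L : Type} [Field L] [CharP L p] (n : ℕ) (a : L) :
    Matrix (Fin (n+1)) (Fin (n+1)) L :=
  fun i l => if (l : ℕ) = i then 1 else if (l : ℕ) = i + 1 then sdiag p a i else 0

lemma genMat_utri (n : ℕ) (a : L) : UTri (genMat p n a) (sdiag p a) := by
  refine ⟨fun i l h => ?_, fun i => ?_, fun i l h => ?_⟩
  · unfold genMat; rw [if_neg (by omega), if_neg (by omega)]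
  · unfold genMat; rw [if_pos rfl]
  · unfold genMat; rw [if_neg (by omega), if_pos h]

lemma char_pow {n : ℕ} (M : Matrix (Fin (n+1)) (Fin (n+1)) L) (k : ℕ) :
    M ^ (p ^ k) = 1 + (M - 1) ^ (p ^ k) := by
  have h : M = 1 + (M - 1) := by abel
  conv_lhs => rw [h]
  rw [add_pow_char_pow_of_commute _ _ (Commute.one_left _), one_pow]

lemma utri_pow_one {n d : ℕ} (hd : n < p ^ d) {M : Matrix (Fin (n+1)) (Fin (n+1)) L} {s : ℕ → L}
    (h : UTri M s) : M ^ (p ^ d) = 1 := by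
  rw [char_pow, h.nilp _ hd, add_zero]

/-- pairs of a unitriangular matrix and the parameter of its superdiagonal -/
def PairGroup (p : ℕ) [hp : Fact p.Prime] (L : Type) [Field L] [CharP L p] (n : ℕ) :
    Subgroup ((Matrix (Fin (n+1)) (Fin (n+1)) L)ˣ × Multiplicative L) where
  carrier := {u | UTri (u.1 : Matrix (Fin (n+1)) (Fin (n+1)) L) (sdiag p (Multiplicative.toAdd u.2)) ∧
    UTri ((u.1⁻¹ : (Matrix (Fin (n+1)) (Fin (n+1)) L)ˣ) : Matrix (Fin (n+1)) (Fin (n+1)) L)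
      (sdiag p (- Multiplicative.toAdd u.2))}
  one_mem' := by
    have h0 : sdiag p (0 : L) = 0 := by
      ext i; simp [sdiag, hp.out.ne_zero]
    constructor
    · simpa [h0] using UTri.one
    · simpa [h0] using UTri.one
  mul_mem' := by
    rintro a b ⟨hs, ht⟩ ⟨hs', ht'⟩
    refine ⟨?_, ?_⟩
    · rw [Prod.snd_mul, toAdd_mul, sdiag_add]
      exact hs.mul hs'
    · rw [Prod.fst_mul, mul_inv_rev, Prod.snd_mul, toAdd_mul, neg_add_rev, sdiag_add]
      exact ht'.mul ht
  inv_mem' := by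
    rintro a ⟨h, h'⟩
    exact ⟨h', by simpa using h⟩

lemma exists_gen (n : ℕ) (a : L) : ∃ u : (Matrix (Fin (n+1)) (Fin (n+1)) L)ˣ,
    (u, Multiplicative.ofAdd a) ∈ PairGroup p L n := by
  have hU := genMat_utri (p := p) n a
  have hlt : n < p ^ (n + 1) := (Nat.lt_succ_self n).trans (Nat.lt_pow_self hp.out.one_lt)
  have h1 := utri_pow_one hlt hU
  have hpos : 0 < p ^ (n + 1) := by omega
  obtain ⟨e, he⟩ : ∃ e, p ^ (n + 1) = e + 1 := ⟨p ^ (n+1) - 1, by omega⟩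
  rw [he] at h1
  refine ⟨⟨genMat p n a, genMat p n a ^ e, ?_, ?_⟩, hU, ?_⟩
  · rw [← pow_succ', h1]
  · rw [← pow_succ, h1]
  · have := hU.pow e
    have he' : e • sdiag p a = sdiag p (-a) := by
      have h2 : (e + 1) • sdiag p a = 0 := by
        rw [← he]
        ext i
        simp
      rw [sdiag_neg, eq_neg_iff_add_eq_zero, ← succ_nsmul, h2]
    rw [he'] at this
    exact this

end five

/-- The main representation of a free group `K`. -/
lemma exists_char_aux (K : Type) [Group K] [IsFreeGroup K] (p : ℕ) [hp : Fact p.Prime]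
    (L : Type) [Field L] [Finite L] [Algebra (ZMod p) L] (d : ℕ)
    (hd : Module.finrank (ZMod p) L = p ^ d) (a : K →* Multiplicative L) :
    ∃ (N Z : Subgroup K) (χ : K → ZMod p) (e : ℕ), N.FiniteIndex ∧ (∀ h, h ^ (p ^ e) ∈ N) ∧
      N ≤ Z ∧ (∀ h ∈ N, χ h = 0) ∧ (∀ y ∈ Z, ∀ z ∈ Z, χ (y * z) = χ y + χ z) ∧
      ∀ h, a h ≠ 1 → h ^ (p ^ d) ∈ Z ∧ χ (h ^ (p ^ d)) ≠ 0 := by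
  have : CharP L p := charP_of_injective_algebraMap (algebraMap (ZMod p) L).injective p
  set n := p ^ d with hn
  have hn0 : 0 < n := pow_pos hp.out.pos _
  let b := IsFreeGroup.basis K
  choose u hu using fun x : L => exists_gen (p := p) n x
  let ρ' : K →* PairGroup p L n := b.lift fun i => ⟨_, hu (Multiplicative.toAdd (a (b i)))⟩
  let ρ : K →* (Matrix (Fin (n+1)) (Fin (n+1)) L)ˣ :=
    (MonoidHom.fst _ _).comp ((PairGroup p L n).subtype.comp ρ')
  have hρ2 : ∀ h, (ρ' h).1.2 = a h := by
    have : (MonoidHom.snd _ _).comp ((PairGroup p L n).subtype.comp ρ') = a := by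
      apply b.ext_hom
      intro i
      have : ρ' (b i) = ⟨_, hu (Multiplicative.toAdd (a (b i)))⟩ := by simp [ρ']
      rw [MonoidHom.comp_apply, MonoidHom.comp_apply, this]
      rfl
    intro h
    exact DFunLike.congr_fun this h
  let m : K → Matrix (Fin (n+1)) (Fin (n+1)) L := fun h => (ρ h).1
  have hm_mul : ∀ g h, m (g * h) = m g * m h := fun g h => by simp [m]
  have hm_one : m 1 = 1 := by simp [m]
  have hm_pow : ∀ g k, m (g ^ k) = m g ^ k := fun g k => by simp [m]
  have hU : ∀ h, UTri (m h) (sdiag p (Multiplicative.toAdd (a h))) := by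
    intro h
    rw [← hρ2]
    exact (ρ' h).2.1
  obtain ⟨π, hπ⟩ := LinearMap.exists_leftInverse_of_injective (Algebra.linearMap (ZMod p) L)
    (LinearMap.ker_eq_bot.2 (algebraMap (ZMod p) L).injective)
  let E : L → Matrix (Fin (n+1)) (Fin (n+1)) L := fun c => Matrix.single 0 (Fin.last n) c
  have h0l : Fin.last n ≠ 0 := by
    intro h
    have := congrArg Fin.val h
    simp at this
    omega
  have hEE : ∀ c c', E c * E c' = 0 := by
    intro c c'
    exact Matrix.single_mul_single_of_ne _ _ _ _ h0l _
  have hEadd : ∀ c c', (1 + E c) * (1 + E c') = 1 + E (c + c') := by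
    intro c c'
    rw [mul_add, add_mul, add_mul, hEE]
    simp [E, Matrix.single_add, add_assoc]
  let Z : Subgroup K :=
    { carrier := {h | ∃ c, m h = 1 + E c}
      one_mem' := ⟨0, by simp [hm_one, E]⟩
      mul_mem' := by
        rintro g h ⟨c, hc⟩ ⟨c', hc'⟩
        exact ⟨c + c', by rw [hm_mul, hc, hc', hEadd]⟩
      inv_mem' := by
        rintro g ⟨c, hc⟩
        refine ⟨-c, ?_⟩
        have h1 : m g⁻¹ * m g = 1 := by rw [← hm_mul, inv_mul_cancel, hm_one]
        have h2 : m g * (1 + E (-c)) = 1 := by rw [hc, hEadd]; simp [E]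
        exact left_inv_eq_right_inv h1 h2 }
  let χ : K → ZMod p := fun h => π (m h 0 (Fin.last n))
  have hχ : ∀ h c, m h = 1 + E c → χ h = π c := by
    intro h c hc
    simp [χ, hc, E, h0l.symm]
  refine ⟨ρ.ker, Z, χ, d + 1, inferInstance, ?_, ?_, ?_, ?_, ?_⟩
  · intro h
    rw [MonoidHom.mem_ker]
    ext1
    change m (h ^ (p ^ (d+1))) = 1
    rw [hm_pow]
    exact utri_pow_one (Nat.pow_lt_pow_right hp.out.one_lt (Nat.lt_succ_self d)) (hU h)
  · intro h hh
    rw [MonoidHom.mem_ker] at hh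
    exact ⟨0, by simp [m, hh, E]⟩
  · intro h hh
    rw [MonoidHom.mem_ker] at hh
    rw [hχ h 0 (by simp [m, hh, E]), map_zero]
  · rintro y ⟨c, hc⟩ z ⟨c', hc'⟩
    rw [hχ y c hc, hχ z c' hc', hχ (y * z) (c + c') (by rw [hm_mul, hc, hc', hEadd]), map_add]
  · intro h hh
    have hx : Multiplicative.toAdd (a h) ≠ 0 := hh
    set x := Multiplicative.toAdd (a h)
    have key : m (h ^ n) = 1 + E (algebraMap (ZMod p) L (Algebra.norm (ZMod p) x)) := by
      have h9 : m h ^ n = 1 + (m h - 1) ^ n := char_pow (m h) d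
      rw [hm_pow, h9, (hU h).corner, FiniteField.algebraMap_norm_eq_prod_pow, hd]
      simp only [Nat.card_zmod]
      rfl
    refine ⟨⟨_, key⟩, ?_⟩
    rw [hχ _ _ key]
    have := LinearMap.congr_fun hπ (Algebra.norm (ZMod p) x)
    simp only [LinearMap.comp_apply, Algebra.linearMap_apply, LinearMap.id_apply] at this
    rw [this]
    exact Algebra.norm_ne_zero_iff.2 hx

lemma exists_char (K : Type) [Group K] [IsFreeGroup K] [hfg : Group.FG K]
    (p : ℕ) [hp : Fact p.Prime] :
    ∃ (N Z : Subgroup K) (χ : K → ZMod p) (e d : ℕ), N.FiniteIndex ∧ (∀ h, h ^ (p ^ e) ∈ N) ∧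
      N ≤ Z ∧ (∀ h ∈ N, χ h = 0) ∧ (∀ y ∈ Z, ∀ z ∈ Z, χ (y * z) = χ y + χ z) ∧
      ∀ h, (∃ η : K →* Multiplicative (ZMod p), η h ≠ 1) →
        h ^ (p ^ d) ∈ Z ∧ χ (h ^ (p ^ d)) ≠ 0 := by
  classical
  have hfin : Finite (K →* Multiplicative (ZMod p)) := by
    obtain ⟨S, hS⟩ := Group.fg_iff.1 hfg
    have := hS.2.to_subtype
    apply Finite.of_injective (fun (f : K →* Multiplicative (ZMod p)) (s : S) => f s)
    intro f g hfg
    apply MonoidHom.eq_of_eqOn_dense hS.1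
    intro s hs
    exact congrFun hfg ⟨s, hs⟩
  have := Fintype.ofFinite (K →* Multiplicative (ZMod p))
  set d := Fintype.card (K →* Multiplicative (ZMod p)) with hd
  have hfr : Module.finrank (ZMod p) (GaloisField p (p ^ d)) = p ^ d :=
    GaloisField.finrank p (pow_ne_zero _ hp.out.ne_zero)
  have hrank : Module.rank (ZMod p) ((K →* Multiplicative (ZMod p)) → ZMod p) <
      Module.rank (ZMod p) (GaloisField p (p ^ d)) := by
    rw [← Module.finrank_eq_rank, ← Module.finrank_eq_rank, hfr, Module.finrank_fintype_fun_eq_card]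
    exact_mod_cast Nat.lt_pow_self hp.out.one_lt
  obtain ⟨ι, hι⟩ := Module.Free.exists_linearMap_injective_of_rank_lt hrank
  let a : K →* Multiplicative (GaloisField p (p ^ d)) := MonoidHom.mk'
    (fun h => Multiplicative.ofAdd (ι fun η => Multiplicative.toAdd (η h))) (by
      intro g h
      rw [← ofAdd_add, ← map_add]
      congr 2
      ext η
      simp)
  obtain ⟨N, Z, χ, e, h1, h2, h3, h4, h5, h6⟩ :=
    exists_char_aux K p (GaloisField p (p ^ d)) d hfr a
  refine ⟨N, Z, χ, e, d, h1, h2, h3, h4, h5, ?_⟩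
  rintro h ⟨η, hη⟩
  apply h6
  intro hah
  have h7 : ι (fun η => Multiplicative.toAdd (η h)) = 0 := hah
  have h8 := hι (h7.trans (map_zero ι).symm)
  exact hη (congrFun h8 η)

end OrbHom
namespace OrbHom

lemma ohom_ne_top_of_char (m : ℕ) (hm : 2 ≤ m) (p : ℕ) [hp : Fact p.Prime]
    (R Z : Subgroup (FreeGroup (Fin m))) [R.Normal] [R.FiniteIndex]
    (χ : FreeGroup (Fin m) → ZMod p) (hRZ : R ≤ Z) (hχR : ∀ r ∈ R, χ r = 0)
    (hadd : ∀ y ∈ Z, ∀ z ∈ Z, χ (y * z) = χ y + χ z) (O : Set (FreeGroup (Fin m)))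
    (hO : ∀ x ∈ O, ∃ M : ℕ, ∀ g, g * x ^ M * g⁻¹ ∈ Z ∧ χ (g * x ^ M * g⁻¹) ≠ 0) :
    OHomology R O ≠ ⊤ := by
  classical
  let ψ : AddChar (ZMod p) ℂ := ZMod.stdAddChar
  have hψ : ∀ c, ψ c = 1 → c = 0 := fun c hc =>
    ZMod.injective_stdAddChar (hc.trans (AddChar.map_zero_eq_one _).symm)
  let W : Submodule ℂ (FreeGroup (Fin m) → ℂ) :=
    { carrier := {f | ∀ z ∈ Z, ∀ g, f (z * g) = ψ (χ z) * f g}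
      zero_mem' := by intro z _ g; simp
      add_mem' := by
        intro f f' hf hf' z hz g
        simp only [Pi.add_apply]
        rw [hf z hz, hf' z hz, mul_add]
      smul_mem' := by
        intro c f hf z hz g
        simp only [Pi.smul_apply, smul_eq_mul]
        rw [hf z hz]; ring }
  have hWR : ∀ f ∈ W, ∀ g, ∀ r ∈ R, f (g * r) = f g := by
    intro f hf g r hr
    have hr' : g * r * g⁻¹ ∈ R := (inferInstance : R.Normal).conj_mem r hr g
    have := hf _ (hRZ hr') g
    rw [inv_mul_cancel_right, hχR _ hr', AddChar.map_zero_eq_one, one_mul] at this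
    exact this
  have hfd : FiniteDimensional ℂ W := by
    let J : W →ₗ[ℂ] (FreeGroup (Fin m) ⧸ R → ℂ) :=
      { toFun := fun f q => f.1 q.out
        map_add' := fun _ _ => rfl
        map_smul' := fun _ _ => rfl }
    apply Module.Finite.of_injective J
    intro f f' hff
    ext g
    have h1 := congrFun hff (g : FreeGroup (Fin m) ⧸ R)
    have h2 : (g : FreeGroup (Fin m) ⧸ R).out⁻¹ * g ∈ R :=
      QuotientGroup.eq.1 (QuotientGroup.out_eq' (g : FreeGroup (Fin m) ⧸ R))
    have h3 := hWR f.1 f.2 (g : FreeGroup (Fin m) ⧸ R).out _ h2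
    have h4 := hWR f'.1 f'.2 (g : FreeGroup (Fin m) ⧸ R).out _ h2
    rw [mul_inv_cancel_left] at h3 h4
    rw [h3, h4]
    exact h1
  have hnt : Nontrivial W := by
    let f : FreeGroup (Fin m) → ℂ := fun g => if g ∈ Z then ψ (χ g) else 0
    have hf : f ∈ W := by
      intro z hz g
      by_cases hg : g ∈ Z
      · simp only [f, if_pos hg, if_pos (Z.mul_mem hz hg), hadd z hz g hg, AddChar.map_add_eq_mul]
      · have : z * g ∉ Z := fun h => hg ((Subgroup.mul_mem_cancel_left Z hz).1 h)
        simp only [f, if_neg hg, if_neg this, mul_zero]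
    refine ⟨⟨⟨f, hf⟩, 0, ?_⟩⟩
    intro h
    have h1 := congrFun (congrArg Subtype.val h) 1
    simp [f, Z.one_mem, hχR 1 R.one_mem] at h1
  let Tr : FreeGroup (Fin m) →* Module.End ℂ W :=
    { toFun := fun g =>
        { toFun := fun f => ⟨fun h => f.1 (h * g), fun z hz h => by
            change f.1 (z * h * g) = ψ (χ z) * f.1 (h * g)
            rw [mul_assoc]; exact f.2 z hz _⟩
          map_add' := fun _ _ => rfl
          map_smul' := fun _ _ => rfl }
      map_one' := by
        ext f h
        simp
      map_mul' := by
        intro g g'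
        ext f h
        simp [mul_assoc] }
  let ρ : FreeGroup (Fin m) →* (W ≃ₗ[ℂ] W) :=
    (LinearMap.GeneralLinearGroup.generalLinearEquiv ℂ W).toMonoidHom.comp Tr.toHomUnits
  have hρ : ∀ g (f : W) h, (ρ g f).1 h = f.1 (h * g) := fun g f h => rfl
  apply ohom_ne_top_of_rep m hm R O ρ
  · intro g hg
    ext f h
    rw [hρ]
    exact hWR f.1 f.2 h g hg
  · intro x hx
    obtain ⟨M, hM⟩ := hO x hx
    refine ⟨M, fun f hf => ?_⟩
    ext g
    have h1 := hρ (x ^ M) f g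
    rw [hf] at h1
    have h2 := f.2 _ (hM g).1 g
    rw [inv_mul_cancel_right, ← h1] at h2
    by_contra h3
    apply (hM g).2
    apply hψ
    exact (mul_eq_right₀ h3).1 h2.symm

end OrbHom

/-- Corollary 3.3 (free case): if O ⊆ F ∖ {1} is contained in the union of finitely many
Aut(F)-orbits, then the O-homology of a suitable normal cover of r-power index is proper. -/
theorem orbit_homology_free (m : ℕ) (hm : 2 ≤ m)
    (r : ℕ) (hr : r.Prime) (hodd : Odd r)
    (O : Set (FreeGroup (Fin m))) (h1 : (1 : FreeGroup (Fin m)) ∉ O)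
    (T : Finset (FreeGroup (Fin m)))
    (hO : ∀ x ∈ O, ∃ t ∈ T, ∃ φ : MulAut (FreeGroup (Fin m)), φ t = x) :
    ∃ R : Subgroup (FreeGroup (Fin m)), R.Normal ∧ R.FiniteIndex ∧
      (∃ k : ℕ, R.index = r ^ k) ∧
      OHomology R O ≠ ⊤ := by
  classical
  have hp : Fact r.Prime := ⟨hr⟩
  obtain ⟨K, hKn, hKf, hKp, hKO⟩ := OrbHom.exists_avoiding m r O h1 T hO
  obtain ⟨N, Z, χ, e, d, hNf, hNp, hNZ, hχN, hadd, hchi⟩ := OrbHom.exists_char K r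
  let N' := N.map K.subtype
  let Z' := Z.map K.subtype
  have hN'f : N'.FiniteIndex := by
    constructor
    rw [Subgroup.index_map_subtype]
    exact mul_ne_zero hNf.index_ne_zero hKf.index_ne_zero
  let R := N'.normalCore
  have hRf : R.FiniteIndex := inferInstanceAs N'.normalCore.FiniteIndex
  have hRn : R.Normal := inferInstanceAs N'.normalCore.Normal
  have hRN : R ≤ N' := Subgroup.normalCore_le N'
  let χ' : FreeGroup (Fin m) → ZMod r := fun g => if h : g ∈ K then χ ⟨g, h⟩ else 0
  have hχ' : ∀ k : K, χ' k = χ k := fun k => by simp [χ', k.2]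
  refine ⟨R, hRn, hRf, ?_, ?_⟩
  · have hpg : IsPGroup r (FreeGroup (Fin m) ⧸ R) := by
      intro q
      induction q using QuotientGroup.induction_on with
      | H g =>
        obtain ⟨k, hk⟩ := hKp g
        refine ⟨k + e, ?_⟩
        rw [← QuotientGroup.mk_pow, QuotientGroup.eq_one_iff]
        intro h
        have hc : h * g ^ r ^ k * h⁻¹ ∈ K := hKn.conj_mem _ hk h
        refine ⟨⟨_, hc⟩ ^ (r ^ e), hNp _, ?_⟩
        simp only [Subgroup.subtype_apply, Subgroup.coe_pow]
        rw [conj_pow, ← pow_mul, ← pow_add]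
    exact IsPGroup.iff_card.1 hpg
  · apply OrbHom.ohom_ne_top_of_char m hm r R Z' χ'
    · exact hRN.trans (Subgroup.map_mono hNZ)
    · intro g hg
      obtain ⟨n, hn, rfl⟩ := hRN hg
      exact (hχ' n).trans (hχN n hn)
    · rintro _ ⟨y, hy, rfl⟩ _ ⟨z, hz, rfl⟩
      have := hadd y hy z hz
      rw [← hχ', ← hχ', ← hχ'] at this
      exact this
    · intro x hx
      have hxK := hKO x hx
      have hex := hKp x
      have hj := Nat.find_spec hex
      have hj0 : Nat.find hex ≠ 0 := by
        intro h0
        rw [h0] at hj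
        simp at hj
        exact hxK hj
      obtain ⟨i, hi⟩ := Nat.exists_eq_succ_of_ne_zero hj0
      have hni : x ^ r ^ i ∉ K := Nat.find_min hex (by omega)
      rw [hi, pow_succ, pow_mul] at hj
      refine ⟨r ^ i * r * r ^ d, fun g => ?_⟩
      have hy : g * x ^ r ^ i * g⁻¹ ∉ K := fun h => hni (by
        have := hKn.conj_mem _ h g⁻¹
        simpa [mul_assoc] using this)
      have hyp : (g * x ^ r ^ i * g⁻¹) ^ r ∈ K := by
        rw [conj_pow]
        exact hKn.conj_mem _ hj g
      have hη := OrbHom.exists_hom_pow_ne K r _ hy hyp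
      obtain ⟨hz, hc⟩ := hchi _ hη
      have heq : g * x ^ (r ^ i * r * r ^ d) * g⁻¹ =
          (((⟨(g * x ^ r ^ i * g⁻¹) ^ r, hyp⟩ : K) ^ r ^ d : K) : FreeGroup (Fin m)) := by
        change _ = ((g * x ^ r ^ i * g⁻¹) ^ r) ^ r ^ d
        rw [conj_pow, conj_pow, pow_mul, pow_mul]
      rw [heq]
      refine ⟨⟨_, hz, rfl⟩, ?_⟩
      rw [hχ']
      exact hc
end
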